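/- arXiv:0912.1912 — 3 statements merged into one kernel-verified Lean document; each statement's English description precedes it below -/
import Mathlib

section
/- Let X and Y be separable Banach spaces and p,q ∈ [1,+∞). Then the following are equivalent: (1) X finitely Hölder(p/q) embeds into ℓ_q(Y); (2) for every sequence (F_n)_{n∈ℕ} of finite subsets of X (each with the metric induced from the norm of X), E((F_n)_{n∈ℕ},p) is Borel reducible to E(Y,q). -/
open Filter Topology MeasureTheory
open scoped ENNReal NNReal

noncomputable section

/-- `E` is Borel reducible to `F`: there is a Borel (measurable) map `θ` such that
`E x y ↔ F (θ x) (θ y)` for all `x, y`. -/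
def BorelReducible {α β : Type*} [MeasurableSpace α] [MeasurableSpace β]
    (E : α → α → Prop) (F : β → β → Prop) : Prop :=
  ∃ θ : α → β, Measurable θ ∧ ∀ x y, E x y ↔ F (θ x) (θ y)

/-- `M` finitely Hölder(`α`) embeds into the normed space `N`: there is a single constant
`A > 0` such that every finite subset of `M` admits a map into `N` which is a
Hölder(`α`) embedding (with constant `A`) on that subset. -/
def FinitelyHolderEmb (M : Type*) [MetricSpace M] (N : Type*) [AddCommGroup N] [Norm N]
    (α : ℝ) : Prop :=
  ∃ A : ℝ, 0 < A ∧ ∀ F : Finset M, ∃ T : M → N,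
    ∀ u ∈ F, ∀ v ∈ F,
      (1/A) * dist u v ^ α ≤ ‖T u - T v‖ ∧ ‖T u - T v‖ ≤ A * dist u v ^ α

/-! ### Auxiliary material -/

section Aux

variable {Y : Type*} [NormedAddCommGroup Y]

/-- partial `q`-power sum of the difference on a block -/
def bsum (q : ℝ) (l r : ℕ) (a b : ℕ → Y) : ℝ := ∑ m ∈ Finset.Ico l r, ‖a m - b m‖ ^ q

lemma bsum_nonneg (q : ℝ) (l r : ℕ) (a b : ℕ → Y) : 0 ≤ bsum q l r a b :=
  Finset.sum_nonneg fun _ _ => Real.rpow_nonneg (norm_nonneg _) _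

lemma bsum_comm (q : ℝ) (l r : ℕ) (a b : ℕ → Y) : bsum q l r a b = bsum q l r b a :=
  Finset.sum_congr rfl fun m _ => by rw [norm_sub_rev]

lemma real_rpow_add_le {q : ℝ} (hq : 1 ≤ q) {a b : ℝ} (ha : 0 ≤ a) (hb : 0 ≤ b) :
    (a + b) ^ q ≤ 2 ^ q * (a ^ q + b ^ q) := by
  have h := NNReal.rpow_add_le_mul_rpow_add_rpow ⟨a, ha⟩ ⟨b, hb⟩ hq
  have h' : (a + b) ^ q ≤ 2 ^ (q - 1) * (a ^ q + b ^ q) := by exact_mod_cast h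
  refine h'.trans ?_
  have : (2:ℝ) ^ (q - 1) ≤ 2 ^ q := Real.rpow_le_rpow_of_exponent_le (by norm_num) (by linarith)
  have := Real.rpow_nonneg ha q
  have := Real.rpow_nonneg hb q
  gcongr

lemma bsum_triangle {q : ℝ} (hq : 1 ≤ q) (l r : ℕ) (a b c : ℕ → Y) :
    bsum q l r a c ≤ 2 ^ q * (bsum q l r a b + bsum q l r b c) := by
  unfold bsum
  rw [← Finset.sum_add_distrib, Finset.mul_sum]
  refine Finset.sum_le_sum fun m _ => ?_
  refine le_trans ?_ (real_rpow_add_le hq (norm_nonneg _) (norm_nonneg _))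
  exact Real.rpow_le_rpow (norm_nonneg _) (norm_sub_le_norm_sub_add_norm_sub _ _ _) (by linarith)

lemma bsum_mono (q : ℝ) {l r l' r' : ℕ} (hl : l' ≤ l) (hr : r ≤ r') (a b : ℕ → Y) :
    bsum q l r a b ≤ bsum q l' r' a b := by
  unfold bsum
  refine Finset.sum_le_sum_of_subset_of_nonneg (Finset.Ico_subset_Ico hl hr)
    fun _ _ _ => Real.rpow_nonneg (norm_nonneg _) _

lemma summable_blocks {f : ℕ → ℝ} (hf : ∀ m, 0 ≤ f m) {l : ℕ → ℕ} (hl : StrictMono l) :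
    Summable f ↔ Summable fun i => ∑ m ∈ Finset.Ico (l i) (l (i + 1)), f m := by
  have key : ∀ k, ∑ i ∈ Finset.range k, ∑ m ∈ Finset.Ico (l i) (l (i + 1)), f m
      = ∑ m ∈ Finset.Ico (l 0) (l k), f m := by
    intro k
    induction k with
    | zero => simp
    | succ k ih =>
      rw [Finset.sum_range_succ, ih, Finset.sum_Ico_consecutive _ (hl.monotone (Nat.zero_le _))
        (hl.monotone (Nat.le_succ _))]
  constructor
  · intro h
    refine summable_of_sum_range_le (c := ∑' m, f m)
      (fun i => Finset.sum_nonneg fun m _ => hf m) fun k => ?_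
    rw [key]
    exact h.sum_le_tsum _ fun m _ => hf m
  · intro h
    refine summable_of_sum_range_le (c := ∑ m ∈ Finset.range (l 0), f m +
      ∑' i, ∑ m ∈ Finset.Ico (l i) (l (i + 1)), f m) hf fun k => ?_
    have h1 : ∑ m ∈ Finset.range k, f m ≤ ∑ m ∈ Finset.range (l k), f m :=
      Finset.sum_le_sum_of_subset_of_nonneg (Finset.range_subset_range.2 (hl.le_apply))
        fun m _ _ => hf m
    refine h1.trans ?_
    rw [← Finset.sum_range_add_sum_Ico _ (hl.monotone (Nat.zero_le k)), ← key]
    gcongr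
    exact h.sum_le_tsum _ fun m _ => Finset.sum_nonneg fun m _ => hf m

lemma eventually_bsum {q : ℝ} {a b : ℕ → Y} (h : Summable fun m => ‖a m - b m‖ ^ q)
    {ε : ℝ} (hε : 0 < ε) : ∀ᶠ l in atTop, ∀ L, bsum q l L a b ≤ ε := by
  have h0 : ∀ m, 0 ≤ ‖a m - b m‖ ^ q := fun m => Real.rpow_nonneg (norm_nonneg _) _
  have := h.hasSum.tendsto_sum_nat
  have h2 := this.eventually (lt_mem_nhds (sub_lt_self (∑' m, ‖a m - b m‖ ^ q) hε))
  filter_upwards [h2] with l hl L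
  rcases le_total l L with hL | hL
  · have h3 := h.sum_le_tsum (Finset.range L) fun m _ => h0 m
    rw [← Finset.sum_range_add_sum_Ico _ hL] at h3
    unfold bsum
    linarith
  · simp [bsum, Finset.Ico_eq_empty_of_le hL, hε.le]

end Aux

section Additive

variable {K : ℕ → Type*}

/-- replace the first `N` coordinates -/
def modi (N : ℕ) (s : ∀ i : Fin N, K i) (x : ∀ n, K n) : ∀ n, K n :=
  fun n => if h : n < N then s ⟨n, h⟩ else x n

lemma modi_lt {N : ℕ} (s : ∀ i : Fin N, K i) (x : ∀ n, K n) {n : ℕ} (h : n < N) :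
    modi N s x n = s ⟨n, h⟩ := by simp [modi, h]

lemma modi_ge {N : ℕ} (s : ∀ i : Fin N, K i) (x : ∀ n, K n) {n : ℕ} (h : N ≤ n) :
    modi N s x n = x n := by simp [modi, h]

variable [∀ n, TopologicalSpace (K n)] [∀ n, DiscreteTopology (K n)]

lemma eventually_cyl {x : ∀ n, K n} {A : Set (∀ n, K n)} (hA : A ∈ 𝓝 x) :
    ∀ᶠ M in atTop, ∀ y : ∀ n, K n, (∀ n < M, y n = x n) → y ∈ A := by
  obtain ⟨_, ⟨w, N, rfl⟩, hx, hsub⟩ := (PiNat.isTopologicalBasis_cylinders K).mem_nhds_iff.1 hA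
  filter_upwards [eventually_ge_atTop N] with M hM y hy
  refine hsub ?_
  rw [PiNat.mem_cylinder_iff] at hx ⊢
  intro i hi
  rw [hy i (hi.trans_le hM), hx i hi]

lemma continuous_modi (N : ℕ) (s : ∀ i : Fin N, K i) : Continuous (modi N s) := by
  refine continuous_pi fun n => ?_
  by_cases h : n < N
  · simp only [modi, h, dif_pos]; exact continuous_const
  · simp only [modi, h, dif_neg, not_false_iff]; exact continuous_apply n

lemma isOpenMap_modi (N : ℕ) (s : ∀ i : Fin N, K i) : IsOpenMap (modi N s) := by
  rw [isOpenMap_iff_nhds_le]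
  intro x A hA
  rw [mem_map] at hA
  obtain ⟨M, hM, hNM⟩ := ((eventually_cyl hA).and (eventually_ge_atTop N)).exists
  refine mem_of_superset ((PiNat.isOpen_cylinder K (modi N s x) M).mem_nhds
    (PiNat.self_mem_cylinder _ _)) ?_
  intro y hy
  rw [PiNat.mem_cylinder_iff] at hy
  have h1 := hM (modi N (fun i => x i) y) (fun n hn => by
    by_cases h : n < N
    · rw [modi_lt _ _ h]
    · rw [modi_ge _ _ (not_lt.1 h), hy n hn, modi_ge _ _ (not_lt.1 h)])
  have h2 : modi N s (modi N (fun i => x i) y) = y := by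
    funext n
    by_cases h : n < N
    · rw [modi_lt _ _ h, hy n (h.trans_le hNM), modi_lt _ _ h]
    · rw [modi_ge _ _ (not_lt.1 h), modi_ge _ _ (not_lt.1 h)]
  rw [Set.mem_preimage, h2] at h1
  exact h1

end Additive

lemma generic_set {P Z : Type*} [TopologicalSpace P] [MeasurableSpace P] [BorelSpace P]
    [BaireSpace P] [TopologicalSpace Z] [SecondCountableTopology Z] [MeasurableSpace Z]
    [OpensMeasurableSpace Z] {θ : P → Z} (hθ : Measurable θ) {ι : Type*} [Countable ι]
    {B : ι → Set P} (hB : ∀ b, MeasurableSet (B b)) :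
    ∃ O : ℕ → Set P, (∀ k, IsOpen (O k)) ∧ (⋂ k, O k) ∈ residual P ∧
      ContinuousOn θ (⋂ k, O k) ∧ ∀ b, ∀ x ∈ B b, x ∈ (⋂ k, O k) → B b ∈ 𝓝[⋂ k, O k] x := by
  have step : ∀ {S : Set P}, MeasurableSet S →
      ∃ R ∈ residual P, ∀ R' ⊆ R, ∀ x ∈ S, x ∈ R' → S ∈ 𝓝[R'] x := by
    intro S hS
    obtain ⟨u, hu, hSu⟩ := hS.residualEq_isOpen
    refine ⟨{x | x ∈ S ↔ x ∈ u}, ?_, ?_⟩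
    · filter_upwards [hSu] with x hx
      exact iff_of_eq hx
    · intro R' hR' x hxS hxR
      rw [mem_nhdsWithin]
      exact ⟨u, hu, (hR' hxR).1 hxS, fun y hy => (hR' hy.2).2 hy.1⟩
  choose! R hR hR' using fun b => step (hB b)
  have hU : ∀ U : TopologicalSpace.countableBasis Z, MeasurableSet (θ ⁻¹' U) := fun U =>
    hθ (TopologicalSpace.isOpen_of_mem_countableBasis U.2).measurableSet
  choose! R2 hR2 hR2' using fun U => step (hU U)
  have hres : (⋂ b, R b) ∩ (⋂ U, R2 U) ∈ residual P := by
    refine inter_mem (countable_iInter_mem.2 hR) ?_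
    have : Countable (TopologicalSpace.countableBasis Z) :=
      (TopologicalSpace.countable_countableBasis Z).to_subtype
    exact countable_iInter_mem.2 hR2
  obtain ⟨t, hts, htG, htd⟩ := mem_residual.1 hres
  obtain ⟨O, hO, rfl⟩ := htG.eq_iInter_nat
  refine ⟨O, hO, mem_residual.2 ⟨_, subset_rfl, htG, htd⟩, ?_, ?_⟩
  · intro x hx
    rw [ContinuousWithinAt,
      (TopologicalSpace.isBasis_countableBasis Z).nhds_hasBasis.tendsto_right_iff]
    rintro U ⟨hUb, hxU⟩
    exact hR2' ⟨U, hUb⟩ _ (fun y hy => Set.mem_iInter.1 (hts hy).2 ⟨U, hUb⟩) x hxU hx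
  · intro b x hxB hx
    exact hR' b _ (fun y hy => Set.mem_iInter.1 (hts hy).1 b) x hxB hx

section Additive2

variable {K : ℕ → Type*} [∀ n, TopologicalSpace (K n)] [∀ n, DiscreteTopology (K n)]
  [∀ n, Finite (K n)] [∀ n, Nonempty (K n)] [∀ n, MeasurableSpace (K n)] [∀ n, BorelSpace (K n)]
  {Y : Type*} [NormedAddCommGroup Y] [SecondCountableTopology Y] [MeasurableSpace Y] [BorelSpace Y]

/-- points at which the effect of changing the first `N` coordinates is small after `l` -/
def Bset (q : ℝ) (θ : (∀ n, K n) → ℕ → Y) (b : ℕ × ℕ) : Set (∀ n, K n) :=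
  {x | ∀ s t : ∀ i : Fin b.1, K i, ∀ L,
    bsum q b.2 L (θ (modi b.1 s x)) (θ (modi b.1 t x)) ≤ (1 / 2) ^ b.1}

lemma measurableSet_Bset (q : ℝ) {θ : (∀ n, K n) → ℕ → Y} (hθ : Measurable θ) (b : ℕ × ℕ) :
    MeasurableSet (Bset q θ b) := by
  have hm : ∀ s : ∀ i : Fin b.1, K i, ∀ m, Measurable fun x => θ (modi b.1 s x) m := fun s m =>
    (measurable_pi_apply m).comp (hθ.comp (continuous_modi b.1 s).measurable)
  have : Bset q θ b = ⋂ s : ∀ i : Fin b.1, K i, ⋂ t : ∀ i : Fin b.1, K i, ⋂ L,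
    {x | bsum q b.2 L (θ (modi b.1 s x)) (θ (modi b.1 t x)) ≤ (1 / 2) ^ b.1} := by
    ext x; simp [Bset]
  rw [this]
  refine MeasurableSet.iInter fun s => MeasurableSet.iInter fun t => MeasurableSet.iInter fun L => ?_
  refine measurableSet_le ?_ measurable_const
  unfold bsum
  refine Finset.measurable_sum _ fun m _ => ?_
  exact ((hm s m).sub (hm t m)).norm.pow_const q

/-- Local structure of a Borel reduction around a generic point. -/
lemma local_structure {q : ℝ} (hq : 1 ≤ q) {θ : (∀ n, K n) → ℕ → Y} (hθ : Measurable θ)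
    (hfin : ∀ x y : ∀ n, K n, ∀ N, (∀ n, N ≤ n → x n = y n) →
      Summable fun m => ‖θ x m - θ y m‖ ^ q) :
    ∃ (C : Set (∀ n, K n)) (O : ℕ → Set (∀ n, K n)) (z : ∀ n, K n) (l Φ : ℕ → ℕ),
      C = (⋂ k, O k) ∧ StrictMono l ∧ ∀ N, N ≤ Φ N ∧ ∀ y : ∀ n, K n,
        (∀ n, N ≤ n → n < Φ N → y n = z n) →
          (∀ k ≤ N, y ∈ O k) ∧
          (y ∈ C → bsum q 0 (l N) (θ y) (θ (modi N (fun i => y i) z)) ≤ (1 / 2) ^ N) ∧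
          (y ∈ C → ∀ y', (∀ n, N ≤ n → y' n = y n) → ∀ L,
            bsum q (l N) L (θ y) (θ y') ≤ (1 / 2) ^ N) := by
  obtain ⟨O, hO, hres, hcont, hB⟩ := generic_set hθ (measurableSet_Bset q hθ)
  set C := ⋂ k, O k with hC
  obtain ⟨z, hz⟩ : ∃ z, ∀ N (s : ∀ i : Fin N, K i), modi N s z ∈ C := by
    have h1 : ∀ᶠ z in residual (∀ n, K n), ∀ N (s : ∀ i : Fin N, K i), modi N s z ∈ C := by
      rw [eventually_countable_forall]
      intro N
      rw [eventually_countable_forall]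
      intro s
      exact tendsto_residual_of_isOpenMap (continuous_modi N s) (isOpenMap_modi N s) hres
    obtain ⟨z, hz⟩ := (dense_of_mem_residual h1).nonempty
    exact ⟨z, hz⟩
  have hl : ∀ N, ∀ᶠ l in atTop, ∀ s : ∀ i : Fin N, K i, modi N s z ∈ Bset q θ (N, l) := by
    intro N
    rw [eventually_all]
    intro s
    simp only [Bset, Set.mem_ofPred_eq]
    rw [eventually_all]
    intro t
    rw [eventually_all]
    intro t'
    refine eventually_bsum (hfin _ _ N ?_) (by positivity)
    intro n hn
    simp only [modi_ge _ _ hn]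
  obtain ⟨l, hlm, hl⟩ := extraction_forall_of_eventually hl
  have hΦ : ∀ N, ∃ M, N ≤ M ∧ ∀ (s : ∀ i : Fin N, K i) (y : ∀ n, K n),
      (∀ n < M, y n = modi N s z n) → (∀ k ≤ N, y ∈ O k) ∧
        (y ∈ C → bsum q 0 (l N) (θ y) (θ (modi N s z)) ≤ (1 / 2) ^ N) ∧
        (y ∈ C → y ∈ Bset q θ (N, l N)) := by
    intro N
    suffices h : ∀ᶠ M in atTop, ∀ (s : ∀ i : Fin N, K i) (y : ∀ n, K n),
      (∀ n < M, y n = modi N s z n) → (∀ k ≤ N, y ∈ O k) ∧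
        (y ∈ C → bsum q 0 (l N) (θ y) (θ (modi N s z)) ≤ (1 / 2) ^ N) ∧
        (y ∈ C → y ∈ Bset q θ (N, l N)) from ((eventually_ge_atTop N).and h).exists
    rw [eventually_all]
    intro s
    refine eventually_cyl (A := {y | (∀ k ≤ N, y ∈ O k) ∧
        (y ∈ C → bsum q 0 (l N) (θ y) (θ (modi N s z)) ≤ (1 / 2) ^ N) ∧
        (y ∈ C → y ∈ Bset q θ (N, l N))}) ?_
    have hw := hz N s
    refine inter_mem ?_ (inter_mem ?_ ?_)
    · change ∀ᶠ y in 𝓝 (modi N s z), ∀ k ≤ N, y ∈ O k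
      exact (eventually_all_finite (Set.finite_Iic N)).2 fun k _ =>
        (hO k).mem_nhds (Set.mem_iInter.1 hw k)
    · have hc : ContinuousWithinAt
          (fun y => bsum q 0 (l N) (θ y) (θ (modi N s z))) C (modi N s z) := by
        unfold bsum
        refine tendsto_finsetSum _ fun m _ => ?_
        have h1 : ContinuousWithinAt (fun y => θ y m) C (modi N s z) :=
          (continuous_apply m).continuousAt.comp_continuousWithinAt (hcont _ hw)
        exact ((h1.sub continuousWithinAt_const).norm.rpow_const (Or.inr (by linarith)))
      have h0 : bsum q 0 (l N) (θ (modi N s z)) (θ (modi N s z)) < (1 / 2) ^ N := by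
        have : bsum q 0 (l N) (θ (modi N s z)) (θ (modi N s z)) = 0 := by
          simp [bsum, Real.zero_rpow (by linarith : q ≠ 0)]
        rw [this]; positivity
      have h2 := hc.eventually (gt_mem_nhds h0)
      rw [eventually_nhdsWithin_iff] at h2
      filter_upwards [h2] with y hy hyC
      exact (hy hyC).le
    · have := hB (N, l N) _ (hl N s) hw
      exact mem_nhdsWithin_iff_eventually.1 this
  choose Φ hΦ1 hΦ2 using hΦ
  refine ⟨C, O, z, l, Φ, rfl, hlm, fun N => ⟨hΦ1 N, fun y hy => ?_⟩⟩
  obtain ⟨h1, h2, h3⟩ := hΦ2 N (fun i => y i) y (fun n hn => by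
    by_cases h : n < N
    · rw [modi_lt _ _ h]
    · rw [modi_ge _ _ (not_lt.1 h), hy n (not_lt.1 h) hn])
  refine ⟨h1, h2, fun hyC y' hy' L => ?_⟩
  have := h3 hyC (fun i => y i) (fun i => y' i) L
  convert this using 3
  · funext n
    by_cases h : n < N
    · rw [modi_lt _ _ h]
    · rw [modi_ge _ _ (not_lt.1 h)]
  · funext n
    by_cases h : n < N
    · rw [modi_lt _ _ h]
    · rw [modi_ge _ _ (not_lt.1 h), hy' n (not_lt.1 h)]

theorem additive_reduction {q : ℝ} (hq : 1 ≤ q) {θ : (∀ n, K n) → ℕ → Y} (hθ : Measurable θ)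
    (hfin : ∀ x y : ∀ n, K n, ∀ N, (∀ n, N ≤ n → x n = y n) →
      Summable fun m => ‖θ x m - θ y m‖ ^ q)
    (Q : ℕ → ℕ → Prop) (hQ : ∀ i M, ∃ n, M ≤ n ∧ Q i n) :
    ∃ (z : ∀ n, K n) (n l : ℕ → ℕ) (g : ∀ i, K (n i) → ℕ → Y),
      StrictMono n ∧ (∀ i, Q i (n i)) ∧
      ∀ x y : ∀ n, K n, (∀ j, j ∉ Set.range n → x j = z j) → (∀ j, j ∉ Set.range n → y j = z j) →
        ((Summable fun m => ‖θ x m - θ y m‖ ^ q) ↔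
          Summable fun i => bsum q (l i) (l (i + 1)) (g i (x (n i))) (g i (y (n i)))) := by
  obtain ⟨C, O, z, l, Φ, hC, hl, hΦ⟩ := local_structure hq hθ hfin
  choose pick hpick1 hpick2 using hQ
  let N : ℕ → ℕ := fun i => Nat.rec 0 (fun i Ni => pick i (Φ Ni) + 1) i
  let n : ℕ → ℕ := fun i => pick i (Φ (N i))
  have hN : ∀ i, N (i + 1) = n i + 1 := fun i => rfl
  have hn1 : ∀ i, Φ (N i) ≤ n i := fun i => hpick1 _ _
  have hNn : ∀ i, N i ≤ n i := fun i => (hΦ _).1.trans (hn1 i)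
  have hNm : StrictMono N := strictMono_nat_of_lt_succ fun i => by
    rw [hN]; exact Nat.lt_succ_of_le (hNn i)
  have hnm : StrictMono n := strictMono_nat_of_lt_succ fun i => by
    have := hNn (i + 1); rw [hN] at this; exact this
  have hlN : StrictMono fun i => l (N i) := hl.comp hNm
  have hag : ∀ x : ∀ n, K n, (∀ j, j ∉ Set.range n → x j = z j) → ∀ i j, N i ≤ j → j < Φ (N i) →
      x j = z j := by
    intro x hx i j h1 h2
    refine hx j ?_
    rintro ⟨k, rfl⟩
    rcases lt_or_ge k i with h | h
    · have h3 : N (k + 1) ≤ N i := hNm.monotone h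
      rw [hN] at h3
      omega
    · have := hnm.monotone h
      have := hn1 i
      omega
  have hmC : ∀ x : ∀ n, K n, (∀ j, j ∉ Set.range n → x j = z j) → x ∈ C := by
    intro x hx
    rw [hC, Set.mem_iInter]
    intro k
    exact ((hΦ (N k)).2 x (hag x hx k)).1 k hNm.le_apply
  refine ⟨z, n, fun i => l (N i), fun i u => θ (Function.update z (n i) u), hnm,
    fun i => hpick2 _ _, ?_⟩
  have herr : ∀ x : ∀ n, K n, (∀ j, j ∉ Set.range n → x j = z j) → ∀ i,
      bsum q (l (N i)) (l (N (i + 1))) (θ x) (θ (Function.update z (n i) (x (n i)))) ≤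
        2 ^ q * (2 * (1 / 2) ^ i) := by
    intro x hx i
    refine (bsum_triangle hq _ _ _ (θ (modi (N (i + 1)) (fun i => x i) z)) _).trans ?_
    have h1 : bsum q (l (N i)) (l (N (i + 1))) (θ x) (θ (modi (N (i + 1)) (fun i => x i) z)) ≤
        (1 / 2) ^ i := by
      refine (bsum_mono q (Nat.zero_le _) le_rfl _ _).trans ?_
      refine (((hΦ (N (i + 1))).2 x (hag x hx (i + 1))).2.1 (hmC x hx)).trans ?_
      exact pow_le_pow_of_le_one (by norm_num) (by norm_num)
        ((Nat.le_succ i).trans hNm.le_apply)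
    have hx' : ∀ j, j ∉ Set.range n → modi (N (i + 1)) (fun i => x i) z j = z j := by
      intro j hj
      by_cases h : j < N (i + 1)
      · rw [modi_lt _ _ h]; exact hx j hj
      · rw [modi_ge _ _ (not_lt.1 h)]
    have h2 : bsum q (l (N i)) (l (N (i + 1))) (θ (modi (N (i + 1)) (fun i => x i) z))
        (θ (Function.update z (n i) (x (n i)))) ≤ (1 / 2) ^ i := by
      refine (((hΦ (N i)).2 _ (hag _ hx' _)).2.2 (hmC _ hx') _ ?_ _).trans ?_
      · intro j hj
        by_cases hji : j = n i
        · subst hji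
          rw [Function.update_self, modi_lt _ _ (by rw [hN]; exact Nat.lt_succ_self _)]
        · rw [Function.update_of_ne hji]
          by_cases h : j < N (i + 1)
          · rw [modi_lt _ _ h]
            refine (hx j ?_).symm
            rintro ⟨k, rfl⟩
            rcases lt_trichotomy k i with hk | hk | hk
            · have h3 : N (k + 1) ≤ N i := hNm.monotone hk
              rw [hN] at h3
              omega
            · exact hji (by rw [hk])
            · have := hnm hk
              rw [hN] at h
              omega
          · rw [modi_ge _ _ (not_lt.1 h)]
      · exact pow_le_pow_of_le_one (by norm_num) (by norm_num) hNm.le_apply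
    have : (0:ℝ) < 2 ^ q := by positivity
    gcongr
    linarith
  intro x y hx hy
  rw [summable_blocks (fun m => Real.rpow_nonneg (norm_nonneg _) _) hlN]
  have hs : Summable fun i : ℕ => (2:ℝ) ^ q * (2 * (1 / 2) ^ i) :=
    (summable_geometric_two.mul_left 2).mul_left _
  have four : ∀ (i : ℕ) (a b c d : ℕ → Y),
      bsum q (l (N i)) (l (N (i + 1))) a b ≤ 2 ^ q * (2 * (1 / 2) ^ i) →
      bsum q (l (N i)) (l (N (i + 1))) c d ≤ 2 ^ q * (2 * (1 / 2) ^ i) →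
      bsum q (l (N i)) (l (N (i + 1))) a d ≤ 2 ^ q * (2 ^ q * (2 * (1 / 2) ^ i) +
        2 ^ q * (bsum q (l (N i)) (l (N (i + 1))) b c + 2 ^ q * (2 * (1 / 2) ^ i))) := by
    intro i a b c d h1 h2
    refine (bsum_triangle hq _ _ _ b _).trans ?_
    have h3 := bsum_triangle hq (l (N i)) (l (N (i + 1))) b c d
    have : (0:ℝ) < 2 ^ q := by positivity
    gcongr
    refine h3.trans ?_
    gcongr
  constructor
  · intro h
    refine Summable.of_nonneg_of_le (fun i => bsum_nonneg _ _ _ _ _) (fun i => four i _ _ _ _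
      (by rw [bsum_comm]; exact herr x hx i) (herr y hy i)) ?_
    exact (hs.add ((h.add hs).mul_left _)).mul_left _
  · intro h
    refine Summable.of_nonneg_of_le (fun i => bsum_nonneg _ _ _ _ _) (fun i => four i _ _ _ _
      (herr x hx i) (by rw [bsum_comm]; exact herr y hy i)) ?_
    exact (hs.add ((h.add hs).mul_left _)).mul_left _

end Additive2

section Final

lemma exists_subset_sum_ge (f : ℕ → ℝ) (s : ℕ) (hs : 0 < s) : ∀ (d : ℕ) (S : Finset ℕ),
    S.card = s + d → ∃ S' ⊆ S, S'.card = s ∧ s * ∑ i ∈ S, f i ≤ S.card * ∑ i ∈ S', f i := by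
  intro d
  induction d with
  | zero =>
    intro S hS
    exact ⟨S, subset_rfl, hS, by rw [hS]; simp⟩
  | succ d ih =>
    intro S hS
    have hne : S.Nonempty := by rw [← Finset.card_pos]; omega
    obtain ⟨a, haS, ha⟩ := S.exists_min_image f hne
    have hc : (S.erase a).card = s + d := by rw [Finset.card_erase_of_mem haS]; omega
    obtain ⟨S', hS', hcard, hsum⟩ := ih (S.erase a) hc
    refine ⟨S', hS'.trans (Finset.erase_subset _ _), hcard, ?_⟩
    have h1 : f a + ∑ i ∈ S.erase a, f i = ∑ i ∈ S, f i := Finset.add_sum_erase S f haS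
    have h2 : (S.card : ℝ) * f a ≤ ∑ i ∈ S, f i := by
      have := Finset.card_nsmul_le_sum S f (f a) ha
      rwa [nsmul_eq_mul] at this
    rw [hc] at hsum
    rw [hS] at h2 ⊢
    push_cast at *
    have hsp : (0:ℝ) < s := by exact_mod_cast hs
    have hd : (0:ℝ) ≤ d := by positivity
    set A := ∑ i ∈ S, f i
    set B := ∑ i ∈ S', f i
    have h3 : ∑ i ∈ S.erase a, f i = A - f a := by linarith
    rw [h3] at hsum
    have hpos : (0:ℝ) < s + d := by linarith
    have h4 : (s + d : ℝ) * (s * A) ≤ (s + d : ℝ) * ((s + (d + 1)) * B) := by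
      nlinarith [mul_le_mul_of_nonneg_left h2 hsp.le,
        mul_le_mul_of_nonneg_left hsum (by linarith : (0:ℝ) ≤ s + (d + 1))]
    exact le_of_mul_le_mul_left h4 hpos

lemma dichotomy (k M : ℕ) (d : ℝ) (r : ℕ → ℝ) (hd : 0 < d) (hdk : d ≤ (1 / 2) ^ k)
    (hM : 1 ≤ M * d)
    (hbad : ¬ (1 / (2 * 4 ^ k) * (M * d) ≤ ∑ j ∈ Finset.range M, r j ∧
      ∑ j ∈ Finset.range M, r j ≤ (2 * 4 ^ k) * (M * d))) :
    ∃ S : Finset ℕ, (S.card * d ≤ (1 / 2) ^ k ∧ 1 ≤ ∑ j ∈ S, r j) ∨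
      (1 ≤ S.card * d ∧ ∑ j ∈ S, r j ≤ (1 / 2) ^ k) := by
  have hMp : (0:ℝ) < M := by
    by_contra h
    have : (M:ℝ) = 0 := le_antisymm (not_lt.1 h) (by positivity)
    rw [this] at hM; linarith
  have hk1 : ((1:ℝ) / 2) ^ k ≤ 1 := pow_le_one₀ (by norm_num) (by norm_num)
  have hk0 : (0:ℝ) < (1 / 2) ^ k := by positivity
  have h4 : (4:ℝ) ^ k * (1 / 2) ^ k = 2 ^ k := by rw [← mul_pow]; norm_num
  have h2k : (1:ℝ) ≤ 2 ^ k := one_le_pow₀ (by norm_num)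
  by_cases hup : ∑ j ∈ Finset.range M, r j ≤ (2 * 4 ^ k) * (M * d)
  · have hlow : ∑ j ∈ Finset.range M, r j < 1 / (2 * 4 ^ k) * (M * d) := by
      by_contra h
      exact hbad ⟨not_lt.1 h, hup⟩
    set s := ⌈1 / d⌉₊ with hs
    have hs1 : 1 / d ≤ s := Nat.le_ceil _
    have hs2 : (s:ℝ) < 1 / d + 1 := Nat.ceil_lt_add_one (by positivity)
    have hs0 : 0 < s := Nat.ceil_pos.2 (by positivity)
    have hsM : s ≤ M := Nat.ceil_le.2 (by rw [div_le_iff₀ hd]; exact hM)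
    obtain ⟨S, -, hcard, hsum⟩ := exists_subset_sum_ge (fun j => - r j) s hs0 (M - s)
      (Finset.range M) (by rw [Finset.card_range]; omega)
    refine ⟨S, Or.inr ⟨?_, ?_⟩⟩
    · rw [hcard]; rwa [div_le_iff₀ hd] at hs1
    · rw [Finset.card_range, Finset.sum_neg_distrib, Finset.sum_neg_distrib] at hsum
      have hsd : s * d ≤ 2 := by
        have := mul_lt_mul_of_pos_right hs2 hd
        rw [add_mul, one_div_mul_cancel hd.ne'] at this
        linarith
      have h5 : (M:ℝ) * ∑ j ∈ S, r j ≤ M * (1 / 4 ^ k) := by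
        have h6 : (M:ℝ) * ∑ j ∈ S, r j ≤ s * ∑ j ∈ Finset.range M, r j := by linarith
        refine h6.trans ?_
        have h7 : (s:ℝ) * ∑ j ∈ Finset.range M, r j ≤ s * (1 / (2 * 4 ^ k) * (M * d)) := by
          gcongr
        refine h7.trans ?_
        have h8 : (s:ℝ) * (1 / (2 * 4 ^ k) * (M * d)) = M * (1 / 4 ^ k) * (s * d / 2) := by
          field_simp
        rw [h8]
        refine mul_le_of_le_one_right (by positivity) (by linarith)
      refine (le_of_mul_le_mul_left h5 hMp).trans ?_
      rw [one_div_pow]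
      exact one_div_le_one_div_of_le (by positivity) (pow_le_pow_left₀ (by norm_num) (by norm_num) k)
  · rw [not_le] at hup
    set s := ⌊(1 / 2) ^ k / d⌋₊ with hs
    have hx1 : 1 ≤ (1 / 2) ^ k / d := by rw [le_div_iff₀ hd]; linarith
    have hs1 : (s:ℝ) ≤ (1 / 2) ^ k / d := Nat.floor_le (by positivity)
    have hs2 : (1 / 2) ^ k / d < s + 1 := Nat.lt_floor_add_one _
    have hs0 : 0 < s := Nat.floor_pos.2 hx1
    have hs0' : (1:ℝ) ≤ s := by exact_mod_cast hs0
    have hsM : s ≤ M := by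
      have : (s:ℝ) ≤ M := hs1.trans (by rw [div_le_iff₀ hd]; linarith)
      exact_mod_cast this
    obtain ⟨S, -, hcard, hsum⟩ := exists_subset_sum_ge r s hs0 (M - s)
      (Finset.range M) (by rw [Finset.card_range]; omega)
    refine ⟨S, Or.inl ⟨?_, ?_⟩⟩
    · rw [hcard]; rwa [le_div_iff₀ hd] at hs1
    · rw [Finset.card_range] at hsum
      have hsd : (1 / 2) ^ k ≤ 2 * (s * d) := by
        rw [div_lt_iff₀ hd] at hs2
        nlinarith
      have h5 : (M:ℝ) * 1 ≤ M * ∑ j ∈ S, r j := by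
        refine le_trans ?_ hsum
        have h7 : (s:ℝ) * ((2 * 4 ^ k) * (M * d)) ≤ s * ∑ j ∈ Finset.range M, r j := by
          gcongr
        refine le_trans ?_ h7
        have h8 : (s:ℝ) * ((2 * 4 ^ k) * (M * d)) = M * (4 ^ k * (2 * (s * d))) := by ring
        rw [h8]
        gcongr
        calc (1:ℝ) ≤ 2 ^ k := h2k
          _ = 4 ^ k * (1 / 2) ^ k := h4.symm
          _ ≤ _ := by gcongr
      exact le_of_mul_le_mul_left h5 hMp

open Classical in
lemma pair_sum (a : ℕ → ℝ) (ha : ∀ i, 0 ≤ a i) (S : ℕ → Finset ℕ) (𝒦 : Set ℕ) :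
    (Summable fun i => if (Nat.unpair i).1 ∈ 𝒦 ∧ (Nat.unpair i).2 ∈ S (Nat.unpair i).1
      then a i else 0) ↔
    Summable fun k => if k ∈ 𝒦 then ∑ j ∈ S k, a (Nat.pair k j) else 0 := by
  rw [← Nat.pairEquiv.summable_iff]
  rw [summable_prod_of_nonneg (by
    intro x; simp only [Function.comp, Pi.zero_apply]; split_ifs
    · exact ha _
    · exact le_rfl)]
  have hz : ∀ k, ∀ j ∉ S k, (if k ∈ 𝒦 ∧ j ∈ S k then a (Nat.pair k j) else 0) = 0 := by
    intro k j hj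
    simp [hj]
  simp only [Function.comp, Nat.pairEquiv_apply, Function.uncurry_apply_pair, Nat.unpair_pair]
  have e : ∀ k, ∑' j, (if k ∈ 𝒦 ∧ j ∈ S k then a (Nat.pair k j) else 0) =
      if k ∈ 𝒦 then ∑ j ∈ S k, a (Nat.pair k j) else 0 := by
    intro k
    rw [tsum_eq_sum (hz k)]
    by_cases hk : k ∈ 𝒦
    · simp only [hk, true_and, if_true]
      exact Finset.sum_congr rfl fun j hj => by simp [hj]
    · simp [hk]
  simp only [e]
  refine and_iff_right fun k => summable_of_ne_finset_zero (hz k)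

variable {X Y : Type*} [NormedAddCommGroup X] [NormedSpace ℝ X]
    [NormedAddCommGroup Y] [NormedSpace ℝ Y]

lemma exists_concat {q : ℝ} (hq : 1 ≤ q) (κ : ℝ) (hκ : 0 ≤ κ) (S : Finset ℕ) (l l' : ℕ → ℕ)
    (G : ℕ → X → ℕ → Y) : ∃ T : X → lp (fun _ : ℕ => Y) (ENNReal.ofReal q), ∀ u v,
      ‖T u - T v‖ ^ q = κ * ∑ j ∈ S, bsum q (l j) (l' j) (G j u) (G j v) := by
  have : Fact (1 ≤ ENNReal.ofReal q) := ⟨by simpa using hq⟩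
  have hq' : (ENNReal.ofReal q).toReal = q := ENNReal.toReal_ofReal (by linarith)
  let J : Finset ℕ := (S.sigma fun j => Finset.Ico (l j) (l' j)).image fun a => Nat.pair a.1 a.2
  refine ⟨fun u => κ ^ (1 / q) • ∑ a ∈ J, lp.single (ENNReal.ofReal q) a
    (G (Nat.unpair a).1 u (Nat.unpair a).2), fun u v => ?_⟩
  rw [← smul_sub, norm_smul, Real.mul_rpow (norm_nonneg _) (norm_nonneg _),
    Real.norm_of_nonneg (Real.rpow_nonneg hκ _), ← Real.rpow_mul hκ,
    one_div_mul_cancel (by linarith), Real.rpow_one, ← Finset.sum_sub_distrib]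
  simp only [← lp.single_sub]
  have h := lp.norm_sum_single (E := fun _ : ℕ => Y) (p := ENNReal.ofReal q) (by rw [hq']; linarith)
    (fun a => G (Nat.unpair a).1 u (Nat.unpair a).2 - G (Nat.unpair a).1 v (Nat.unpair a).2) J
  rw [hq'] at h
  rw [h]
  congr 1
  rw [Finset.sum_image]
  · rw [Finset.sum_sigma]
    simp [bsum]
  · rintro ⟨a, b⟩ - ⟨c, d⟩ - hab
    obtain ⟨rfl, rfl⟩ := Nat.pair_eq_pair.1 hab
    rfl

lemma exists_bad {p q : ℝ} (hp : 1 ≤ p) (hq : 1 ≤ q)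
    (h : ¬ FinitelyHolderEmb X (lp (fun _ : ℕ => Y) (ENNReal.ofReal q)) (p / q))
    (c δ : ℝ) (hc : 0 < c) (hδ : 0 < δ) :
    ∃ H : Finset X, (∀ u ∈ H, ∀ v ∈ H, dist u v ^ p ≤ δ) ∧
      ∀ T : X → lp (fun _ : ℕ => Y) (ENNReal.ofReal q), ∃ u ∈ H, ∃ v ∈ H,
        ¬ (1 / c * dist u v ^ p ≤ ‖T u - T v‖ ^ q ∧ ‖T u - T v‖ ^ q ≤ c * dist u v ^ p) := by
  classical
  have : Fact (1 ≤ ENNReal.ofReal q) := ⟨by simpa using hq⟩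
  have hq0 : 0 < q := by linarith
  have hp0 : 0 < p := by linarith
  unfold FinitelyHolderEmb at h
  push Not at h
  obtain ⟨G, hG⟩ := h (c ^ (1 / q)) (by positivity)
  obtain ⟨D, hD0, hD⟩ : ∃ D : ℝ, 0 < D ∧ ∀ u ∈ G, ∀ v ∈ G, dist u v ≤ D := by
    obtain ⟨D, hD⟩ := Metric.isBounded_iff.1 G.finite_toSet.isBounded
    exact ⟨max D 1, by positivity, fun u hu v hv => (hD hu hv).trans (le_max_left _ _)⟩
  set lam : ℝ := δ ^ (1 / p) / D with hlam
  have hlam0 : 0 < lam := by positivity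
  have hdist : ∀ u v : X, dist (lam • u) (lam • v) = lam * dist u v := by
    intro u v
    rw [dist_smul₀, Real.norm_of_nonneg hlam0.le]
  refine ⟨G.image fun u => lam • u, ?_, ?_⟩
  · intro u' hu' v' hv'
    obtain ⟨u, hu, rfl⟩ := Finset.mem_image.1 hu'
    obtain ⟨v, hv, rfl⟩ := Finset.mem_image.1 hv'
    rw [hdist]
    calc (lam * dist u v) ^ p ≤ (lam * D) ^ p := by
          gcongr; exact hD u hu v hv
      _ = δ := by
          rw [hlam, div_mul_cancel₀ _ hD0.ne', ← Real.rpow_mul hδ.le, one_div_mul_cancel hp0.ne',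
            Real.rpow_one]
  · intro T
    by_contra hcon
    push Not at hcon
    obtain ⟨u, hu, v, hv, huv⟩ := hG fun u => lam ^ (-(p / q)) • T (lam • u)
    obtain ⟨h1, h2⟩ := hcon _ (Finset.mem_image_of_mem _ hu) _ (Finset.mem_image_of_mem _ hv)
    rw [hdist, Real.mul_rpow hlam0.le dist_nonneg] at h1 h2
    set t := ‖T (lam • u) - T (lam • v)‖ with ht
    have ht0 : 0 ≤ t := norm_nonneg _
    have hnorm : ‖lam ^ (-(p / q)) • T (lam • u) - lam ^ (-(p / q)) • T (lam • v)‖ =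
        lam ^ (-(p / q)) * t := by
      rw [← smul_sub, norm_smul, Real.norm_of_nonneg (by positivity)]
    have hpow : (lam ^ (-(p / q)) * t) ^ q = lam ^ (-p) * t ^ q := by
      rw [Real.mul_rpow (by positivity) ht0, ← Real.rpow_mul hlam0.le]
      congr 2
      field_simp
    have hl1 : lam ^ (-p) * lam ^ p = 1 := by
      rw [← Real.rpow_add hlam0]; simp
    have hd : (dist u v ^ (p / q)) ^ q = dist u v ^ p := by
      rw [← Real.rpow_mul dist_nonneg, div_mul_cancel₀ _ hq0.ne']
    have hcq : (c ^ (1 / q)) ^ q = c := by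
      rw [← Real.rpow_mul hc.le, one_div_mul_cancel hq0.ne', Real.rpow_one]
    have hln : 0 < lam ^ (-p) := by positivity
    have := huv (by
      rw [hnorm, ← Real.rpow_le_rpow_iff (by positivity) (by positivity) hq0, hpow,
        Real.mul_rpow (by positivity) (by positivity), hd, Real.div_rpow zero_le_one (by positivity),
        hcq, Real.one_rpow]
      calc 1 / c * dist u v ^ p = lam ^ (-p) * lam ^ p * (1 / c * dist u v ^ p) := by rw [hl1]; ring
        _ = lam ^ (-p) * (1 / c * (lam ^ p * dist u v ^ p)) := by ring
        _ ≤ _ := by gcongr)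
    rw [hnorm, ← Real.rpow_lt_rpow_iff (by positivity) (by positivity) hq0, hpow,
        Real.mul_rpow (by positivity) (by positivity), hd, hcq] at this
    have h3 : lam ^ (-p) * t ^ q ≤ c * dist u v ^ p := by
      calc _ ≤ lam ^ (-p) * (c * (lam ^ p * dist u v ^ p)) := by gcongr
        _ = lam ^ (-p) * lam ^ p * (c * dist u v ^ p) := by ring
        _ = _ := by rw [hl1]; ring
    linarith

lemma unpair_sum {a : ℕ → ℕ → ℝ} {b : ℕ → ℝ} (ha : ∀ n m, 0 ≤ a n m)
    (hs : ∀ n, HasSum (a n) (b n)) :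
    (Summable fun i => a (Nat.unpair i).1 (Nat.unpair i).2) ↔ Summable b := by
  rw [← Nat.pairEquiv.summable_iff, summable_prod_of_nonneg (by intro x; exact ha _ _)]
  simp only [Function.comp_apply, Nat.pairEquiv_apply, Function.uncurry_apply_pair,
    Nat.unpair_pair]
  rw [and_iff_right fun n => (hs n).summable]
  exact iff_of_eq (congrArg Summable (funext fun n => (hs n).tsum_eq))

lemma forward_dir [MeasurableSpace X] [BorelSpace X] [MeasurableSpace Y]
    {p q : ℝ} (hp : 1 ≤ p) (hq : 1 ≤ q)
    (h : FinitelyHolderEmb X (lp (fun _ : ℕ => Y) (ENNReal.ofReal q)) (p / q)) (F : ℕ → Finset X) :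
    BorelReducible
      (fun x y : ∀ n, {u : X // u ∈ F n} => Summable fun n => dist (x n) (y n) ^ p)
      (fun x y : ℕ → Y => Summable fun n => ‖x n - y n‖ ^ q) := by
  have : Fact (1 ≤ ENNReal.ofReal q) := ⟨by simpa using hq⟩
  have hq' : (ENNReal.ofReal q).toReal = q := ENNReal.toReal_ofReal (by linarith)
  have hq0 : 0 < q := by linarith
  obtain ⟨A, hA, hT⟩ := h
  choose T hT using fun n => hT (F n)
  refine ⟨fun x a => T (Nat.unpair a).1 (x (Nat.unpair a).1 : X) (Nat.unpair a).2, ?_, ?_⟩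
  · refine measurable_pi_lambda _ fun a => ?_
    exact (measurable_of_finite (fun u : {u : X // u ∈ F (Nat.unpair a).1} =>
      T (Nat.unpair a).1 (u : X) (Nat.unpair a).2)).comp (measurable_pi_apply _)
  · intro x y
    have hs : ∀ n, HasSum (fun m => ‖T n (x n : X) m - T n (y n : X) m‖ ^ q)
        (‖T n (x n : X) - T n (y n : X)‖ ^ q) := by
      intro n
      have := lp.hasSum_norm (by rw [hq']; exact hq0) (T n (x n : X) - T n (y n : X))
      rw [hq'] at this
      exact this
    have e : (Summable fun a : ℕ => ‖T (Nat.unpair a).1 (x (Nat.unpair a).1 : X) (Nat.unpair a).2 -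
        T (Nat.unpair a).1 (y (Nat.unpair a).1 : X) (Nat.unpair a).2‖ ^ q) ↔
        Summable fun n => ‖T n (x n : X) - T n (y n : X)‖ ^ q := by
      exact unpair_sum (a := fun n m => ‖T n (x n : X) m - T n (y n : X) m‖ ^ q)
        (fun n m => Real.rpow_nonneg (norm_nonneg _) _) hs
    refine Iff.trans ?_ e.symm
    have hd : ∀ n, (dist (x n) (y n) ^ (p / q)) ^ q = dist (x n) (y n) ^ p := fun n => by
      rw [← Real.rpow_mul dist_nonneg, div_mul_cancel₀ _ hq0.ne']
    have hb : ∀ n, dist (x n) (y n) ^ p ≤ A ^ q * ‖T n (x n : X) - T n (y n : X)‖ ^ q := by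
      intro n
      rw [← Real.mul_rpow hA.le (norm_nonneg _), ← hd]
      refine Real.rpow_le_rpow (by positivity) ?_ hq0.le
      have := (hT n _ (x n).2 _ (y n).2).1
      rw [one_div, inv_mul_le_iff₀ hA] at this
      exact this
    have hb' : ∀ n, ‖T n (x n : X) - T n (y n : X)‖ ^ q ≤ A ^ q * dist (x n) (y n) ^ p := by
      intro n
      rw [← hd, ← Real.mul_rpow hA.le (by positivity)]
      exact Real.rpow_le_rpow (norm_nonneg _) (hT n _ (x n).2 _ (y n).2).2 hq0.le
    constructor
    · intro h
      exact Summable.of_nonneg_of_le (fun n => Real.rpow_nonneg (norm_nonneg _) _) hb'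
        (h.mul_left _)
    · intro h
      exact Summable.of_nonneg_of_le (fun n => Real.rpow_nonneg dist_nonneg _) hb
        (h.mul_left _)

open Classical in
lemma backward_dir [MeasurableSpace X] [BorelSpace X]
    [SecondCountableTopology Y] [MeasurableSpace Y] [BorelSpace Y]
    {p q : ℝ} (hp : 1 ≤ p) (hq : 1 ≤ q)
    (h : ∀ F : ℕ → Finset X, BorelReducible
      (fun x y : ∀ n, {u : X // u ∈ F n} => Summable fun n => dist (x n) (y n) ^ p)
      (fun x y : ℕ → Y => Summable fun n => ‖x n - y n‖ ^ q)) :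
    FinitelyHolderEmb X (lp (fun _ : ℕ => Y) (ENNReal.ofReal q)) (p / q) := by
  by_contra hcon
  have hq0 : 0 < q := by linarith
  have hp0 : 0 < p := by linarith
  choose H hH1 hH2 using fun k : ℕ => exists_bad hp hq hcon (2 * 4 ^ k) ((1 / 2) ^ k)
    (by positivity) (by positivity)
  have hne : ∀ k, (H k).Nonempty := fun k => by
    obtain ⟨u, hu, -⟩ := hH2 k 0
    exact ⟨u, hu⟩
  have hM : ∀ k, ∃ M : ℕ, 1 ≤ M ∧ ∀ u ∈ H k, ∀ v ∈ H k, u ≠ v → 1 ≤ M * dist u v ^ p := by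
    intro k
    refine ((eventually_ge_atTop 1).and ?_).exists (f := atTop)
    rw [eventually_all_finset]
    intro u _
    rw [eventually_all_finset]
    intro v _
    by_cases huv : u = v
    · simp [huv]
    have hpos : 0 < dist u v ^ p := Real.rpow_pos_of_pos (dist_pos.2 huv) _
    filter_upwards [tendsto_natCast_atTop_atTop.eventually_ge_atTop (1 / dist u v ^ p)] with M hM _
    rwa [div_le_iff₀ hpos] at hM
  choose M hM1 hM2 using hM
  let F : ℕ → Finset X := fun n => H (Nat.unpair n).1
  obtain ⟨θ, hθ, hred⟩ := h F
  have hneF : ∀ n, Nonempty {u : X // u ∈ F n} := fun n => (hne _).to_subtype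
  have hfin : ∀ x y : ∀ n, {u : X // u ∈ F n}, ∀ N, (∀ n, N ≤ n → x n = y n) →
      Summable fun m => ‖θ x m - θ y m‖ ^ q := by
    intro x y N hxy
    refine (hred x y).1 ?_
    refine summable_of_ne_finset_zero (s := Finset.range N) fun n hn => ?_
    rw [hxy n (by simpa using hn), dist_self, Real.zero_rpow hp0.ne']
  obtain ⟨z, n, l, g, hnm, hQ, hadd⟩ := additive_reduction hq hθ hfin
    (fun i n => (Nat.unpair n).1 = (Nat.unpair i).1)
    (fun i M => ⟨Nat.pair (Nat.unpair i).1 M, Nat.right_le_pair _ _, by simp⟩)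
  let el : ∀ j, X → {u : X // u ∈ F j} := fun j u => if hu : u ∈ F j then ⟨u, hu⟩ else z j
  have hel : ∀ j u, u ∈ F j → (el j u : X) = u := by
    intro j u hu
    simp [el, hu]
  let r : ℕ → X → X → ℝ := fun i u v =>
    bsum q (l i) (l (i + 1)) (g i (el (n i) u)) (g i (el (n i) v))
  have hr0 : ∀ i u v, 0 ≤ r i u v := fun i u v => bsum_nonneg _ _ _ _ _
  have hbsame : ∀ i (a : ℕ → Y), bsum q (l i) (l (i + 1)) a a = 0 := by
    intro i a; simp [bsum, Real.zero_rpow hq0.ne']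
  have hch : ∀ k, ∃ u ∈ H k, ∃ v ∈ H k, ∃ S : Finset ℕ,
      (S.card * dist u v ^ p ≤ (1 / 2) ^ k ∧ 1 ≤ ∑ j ∈ S, r (Nat.pair k j) u v) ∨
      (1 ≤ S.card * dist u v ^ p ∧ ∑ j ∈ S, r (Nat.pair k j) u v ≤ (1 / 2) ^ k) := by
    intro k
    have hMp : (0:ℝ) < M k := by exact_mod_cast hM1 k
    obtain ⟨T, hT⟩ := exists_concat (X := X) (Y := Y) hq (1 / M k) (by positivity)
      (Finset.range (M k)) (fun j => l (Nat.pair k j)) (fun j => l (Nat.pair k j + 1))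
      (fun j u => g (Nat.pair k j) (el (n (Nat.pair k j)) u))
    obtain ⟨u, hu, v, hv, hbad⟩ := hH2 k T
    have hT' : ‖T u - T v‖ ^ q = 1 / M k * ∑ j ∈ Finset.range (M k), r (Nat.pair k j) u v := hT u v
    have huv : u ≠ v := by
      rintro rfl
      apply hbad
      simp [Real.zero_rpow hq0.ne', Real.zero_rpow hp0.ne']
    have hd : 0 < dist u v ^ p := Real.rpow_pos_of_pos (dist_pos.2 huv) _
    refine ⟨u, hu, v, hv, dichotomy k (M k) (dist u v ^ p) (fun j => r (Nat.pair k j) u v) hd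
      (hH1 k u hu v hv) (hM2 k u hu v hv huv) ?_⟩
    rintro ⟨h1, h2⟩
    apply hbad
    rw [hT']
    constructor
    · rw [one_div_mul_eq_div (M k : ℝ), le_div_iff₀ hMp]
      linarith
    · rw [one_div_mul_eq_div (M k : ℝ), div_le_iff₀ hMp]
      linarith
  choose u hu v hv S hS using hch
  have key : ∀ 𝒦 : Set ℕ,
      (Summable fun k => if k ∈ 𝒦 then (S k).card * dist (u k) (v k) ^ p else 0) ↔
      (Summable fun k => if k ∈ 𝒦 then ∑ j ∈ S k, r (Nat.pair k j) (u k) (v k) else 0) := by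
    intro 𝒦
    let cond : ℕ → Prop := fun i => (Nat.unpair i).1 ∈ 𝒦 ∧ (Nat.unpair i).2 ∈ S (Nat.unpair i).1
    let pt : (ℕ → X) → ∀ j, {u : X // u ∈ F j} := fun w j =>
      if (∃ i, n i = j ∧ cond i) then el j (w (Nat.unpair j).1) else z j
    have hptz : ∀ w j, j ∉ Set.range n → pt w j = z j := by
      intro w j hj
      have : ¬ ∃ i, n i = j ∧ cond i := by
        rintro ⟨i, rfl, -⟩
        exact hj ⟨i, rfl⟩
      simp only [pt, if_neg this]
    have hptn : ∀ w i, pt w (n i) = if cond i then el (n i) (w (Nat.unpair i).1) else z (n i) := by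
      intro w i
      have : (∃ i', n i' = n i ∧ cond i') ↔ cond i := by
        constructor
        · rintro ⟨i', h1, h2⟩
          rwa [hnm.injective h1] at h2
        · intro h
          exact ⟨i, rfl, h⟩
      simp only [pt, this, hQ i]
    have hu' : ∀ i, u (Nat.unpair i).1 ∈ F (n i) := fun i => by
      change _ ∈ H _
      rw [hQ i]; exact hu _
    have hv' : ∀ i, v (Nat.unpair i).1 ∈ F (n i) := fun i => by
      change _ ∈ H _
      rw [hQ i]; exact hv _
    have h1 := hred (pt u) (pt v)
    simp only at h1
    rw [hadd (pt u) (pt v) (hptz u) (hptz v), ← hnm.injective.summable_iff (by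
      intro j hj
      rw [hptz u j hj, hptz v j hj, dist_self, Real.zero_rpow hp0.ne'])] at h1
    have e1 : ((fun j => dist (pt u j) (pt v j) ^ p) ∘ n) = fun i =>
        if (Nat.unpair i).1 ∈ 𝒦 ∧ (Nat.unpair i).2 ∈ S (Nat.unpair i).1 then
          dist (u (Nat.unpair i).1) (v (Nat.unpair i).1) ^ p else 0 := by
      funext i
      simp only [Function.comp, hptn]
      by_cases hc : cond i
      · rw [if_pos hc, if_pos hc, if_pos hc, Subtype.dist_eq, hel _ _ (hu' i), hel _ _ (hv' i)]
      · rw [if_neg hc, if_neg hc, if_neg hc, dist_self, Real.zero_rpow hp0.ne']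
    have e2 : (fun i => bsum q (l i) (l (i + 1)) (g i (pt u (n i))) (g i (pt v (n i)))) = fun i =>
        if (Nat.unpair i).1 ∈ 𝒦 ∧ (Nat.unpair i).2 ∈ S (Nat.unpair i).1 then
          r i (u (Nat.unpair i).1) (v (Nat.unpair i).1) else 0 := by
      funext i
      simp only [hptn]
      by_cases hc : cond i
      · rw [if_pos hc, if_pos hc, if_pos hc]
      · rw [if_neg hc, if_neg hc, if_neg hc, hbsame]
    rw [e1, e2, pair_sum (fun i => dist (u (Nat.unpair i).1) (v (Nat.unpair i).1) ^ p)
      (fun i => Real.rpow_nonneg dist_nonneg _),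
      pair_sum (fun i => r i (u (Nat.unpair i).1) (v (Nat.unpair i).1)) (fun i => hr0 _ _ _)] at h1
    simpa [Nat.unpair_pair] using h1
  have hgeo : Summable fun k : ℕ => ((1:ℝ) / 2) ^ k := summable_geometric_two
  have fin1 : ∀ (𝒦 : Set ℕ) (a b : ℕ → ℝ), (∀ k, 0 ≤ a k) → (∀ k ∈ 𝒦, a k ≤ (1 / 2) ^ k) →
      (∀ k ∈ 𝒦, 1 ≤ b k) → ((Summable fun k => if k ∈ 𝒦 then a k else 0) →
      Summable fun k => if k ∈ 𝒦 then b k else 0) → ∀ᶠ k in atTop, k ∉ 𝒦 := by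
    intro 𝒦 a b ha hab hb himp
    have h1 : Summable fun k => if k ∈ 𝒦 then a k else 0 := by
      refine Summable.of_nonneg_of_le (fun k => ?_) (fun k => ?_) hgeo
      · split_ifs
        · exact ha k
        · exact le_rfl
      · split_ifs with hk
        · exact hab k hk
        · positivity
    have h2 := (himp h1).tendsto_atTop_zero
    filter_upwards [h2.eventually (gt_mem_nhds zero_lt_one)] with k hk hk'
    rw [if_pos hk'] at hk
    linarith [hb k hk']
  let U : Set ℕ := {k | (S k).card * dist (u k) (v k) ^ p ≤ (1 / 2) ^ k ∧
    1 ≤ ∑ j ∈ S k, r (Nat.pair k j) (u k) (v k)}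
  have f1 := fin1 U (fun k => (S k).card * dist (u k) (v k) ^ p) _
    (fun k => by positivity) (fun k hk => hk.1) (fun k hk => hk.2) (key U).1
  have hL : ∀ k ∈ Uᶜ, 1 ≤ (S k).card * dist (u k) (v k) ^ p ∧
      ∑ j ∈ S k, r (Nat.pair k j) (u k) (v k) ≤ (1 / 2) ^ k := fun k hk =>
    (hS k).resolve_left hk
  have f2 := fin1 Uᶜ (fun k => ∑ j ∈ S k, r (Nat.pair k j) (u k) (v k)) _
    (fun k => Finset.sum_nonneg fun j _ => hr0 _ _ _) (fun k hk => (hL k hk).2)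
    (fun k hk => (hL k hk).1) (key Uᶜ).2
  obtain ⟨k, h1, h2⟩ := (f1.and f2).exists
  exact h2 h1

end Final

theorem finHolderEmb_iff_finite_reducible {X Y : Type*}
    [NormedAddCommGroup X] [NormedSpace ℝ X] [CompleteSpace X]
    [TopologicalSpace.SeparableSpace X] [MeasurableSpace X] [BorelSpace X]
    [NormedAddCommGroup Y] [NormedSpace ℝ Y] [CompleteSpace Y]
    [TopologicalSpace.SeparableSpace Y] [MeasurableSpace Y] [BorelSpace Y]
    (p q : ℝ) (hp : 1 ≤ p) (hq : 1 ≤ q) :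
    FinitelyHolderEmb X (lp (fun _ : ℕ => Y) (ENNReal.ofReal q)) (p/q) ↔
      ∀ F : ℕ → Finset X,
        BorelReducible
          (fun x y : ∀ n, {u : X // u ∈ F n} => Summable fun n => dist (x n) (y n) ^ p)
          (fun x y : ℕ → Y => Summable fun n => ‖x n - y n‖ ^ q) := by
  have : SecondCountableTopology Y := UniformSpace.secondCountable_of_separable Y
  exact ⟨fun h F => forward_dir hp hq h F, fun h => backward_dir hp hq h⟩
end
end

section
/- Let X and Y be separable Banach spaces and p,q ∈ [1,+∞). If E(X,p) is Borel reducible to E(Y,q), then X finitely Hölder(p/q) embeds into ℓ_q(Y). -/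
open Filter Topology MeasureTheory
open scoped ENNReal NNReal

noncomputable section

lemma exists_residual_continuousOn {Z W : Type*} [TopologicalSpace Z] [MeasurableSpace Z]
    [BorelSpace Z] [TopologicalSpace W] [SecondCountableTopology W] [MeasurableSpace W]
    [OpensMeasurableSpace W] (f : Z → W) (hf : Measurable f) :
    ∃ G ∈ residual Z, ContinuousOn f G := by
  have hB := TopologicalSpace.isBasis_countableBasis W
  have h1 : ∀ V : TopologicalSpace.countableBasis W,
      ∃ U : Set Z, IsOpen U ∧ (f ⁻¹' V.1) =ᶠ[residual Z] U := fun V =>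
    MeasurableSet.residualEq_isOpen (hf (hB.isOpen V.2).measurableSet)
  choose U hU hUV using h1
  have : Countable (TopologicalSpace.countableBasis W) :=
    (TopologicalSpace.countable_countableBasis W).to_subtype
  have h2 : ∀ᶠ x in residual Z, ∀ V : TopologicalSpace.countableBasis W,
      (x ∈ f ⁻¹' V.1 ↔ x ∈ U V) := by
    rw [eventually_countable_forall]
    intro V
    filter_upwards [hUV V] with x hx
    exact Iff.of_eq hx
  refine ⟨_, h2, ?_⟩
  intro x hx
  rw [ContinuousWithinAt, hB.nhds_hasBasis.tendsto_right_iff]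
  rintro V ⟨hV, hxV⟩
  have hxU : x ∈ U ⟨V, hV⟩ := (hx ⟨V, hV⟩).1 hxV
  filter_upwards [mem_nhdsWithin_of_mem_nhds ((hU ⟨V, hV⟩).mem_nhds hxU),
    self_mem_nhdsWithin] with y hy hyG
  exact (hyG ⟨V, hV⟩).2 hy

section cat
variable {K : ℕ → Type*}

def mixF (j : ℕ) (r : (i : Fin j) → K i) (z : (i : ℕ) → K i) : (i : ℕ) → K i :=
  fun i => if h : i < j then r ⟨i, h⟩ else z i

lemma mixF_lt {j : ℕ} {r : (i : Fin j) → K i} {z : (i : ℕ) → K i} {i : ℕ} (h : i < j) :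
    mixF j r z i = r ⟨i, h⟩ := by simp [mixF, h]

lemma mixF_ge {j : ℕ} {r : (i : Fin j) → K i} {z : (i : ℕ) → K i} {i : ℕ} (h : j ≤ i) :
    mixF j r z i = z i := by simp [mixF, not_lt.2 h]

variable [∀ i, TopologicalSpace (K i)]

lemma continuous_mixF (j : ℕ) (r : (i : Fin j) → K i) : Continuous (mixF j r) := by
  refine continuous_pi fun i => ?_
  by_cases h : i < j
  · simp only [mixF_lt h]; exact continuous_const
  · simp only [mixF_ge (not_lt.1 h)]; exact continuous_apply i

variable [∀ i, DiscreteTopology (K i)]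

lemma exists_cyl {U : Set ((i : ℕ) → K i)} {z : (i : ℕ) → K i} (hU : U ∈ 𝓝 z) :
    ∃ m, ∀ x, (∀ i < m, x i = z i) → x ∈ U := by
  obtain ⟨V, ⟨y, n, rfl⟩, hz, hV⟩ :=
    (PiNat.isTopologicalBasis_cylinders (E := K)).mem_nhds_iff.1 hU
  refine ⟨n, fun x hx => hV ?_⟩
  rw [PiNat.mem_cylinder_iff] at *
  intro i hi
  rw [hx i hi, hz i hi]

lemma cyl_mem_nhds (z : (i : ℕ) → K i) (m : ℕ) : {x | ∀ i < m, x i = z i} ∈ 𝓝 z :=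
  (PiNat.isOpen_cylinder K z m).mem_nhds (PiNat.self_mem_cylinder z m)

lemma isOpenMap_mixF (j : ℕ) (r : (i : Fin j) → K i) : IsOpenMap (mixF j r) := by
  rw [isOpenMap_iff_nhds_le]
  intro z
  let g : ((i : ℕ) → K i) → (i : ℕ) → K i := mixF j (fun i => z i)
  have hg : g (mixF j r z) = z := by
    funext i
    by_cases h : i < j
    · exact mixF_lt h
    · simp only [g]; rw [mixF_ge (not_lt.1 h), mixF_ge (not_lt.1 h)]
  have he : mixF j r ∘ g =ᶠ[𝓝 (mixF j r z)] id := by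
    filter_upwards [cyl_mem_nhds (mixF j r z) j] with x hx
    funext i
    by_cases h : i < j
    · simp only [Function.comp, mixF_lt h, id]; rw [hx i h, mixF_lt h]
    · simp only [Function.comp, g, mixF_ge (not_lt.1 h), id]
  have hc : Tendsto g (𝓝 (mixF j r z)) (𝓝 z) := by
    have := (continuous_mixF j (fun i => z i)).tendsto (mixF j r z)
    change Tendsto g _ (𝓝 (g (mixF j r z))) at this
    rwa [hg] at this
  calc 𝓝 (mixF j r z) = Filter.map (mixF j r ∘ g) (𝓝 (mixF j r z)) := by
        rw [Filter.map_congr he, Filter.map_id]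
    _ = Filter.map (mixF j r) (Filter.map g (𝓝 (mixF j r z))) := Filter.map_map.symm
    _ ≤ _ := Filter.map_mono hc

variable [∀ i, Finite (K i)] [∀ i, Nonempty (K i)] [∀ i, MeasurableSpace (K i)]
  [∀ i, BorelSpace (K i)]
  {Y : Type*} [NormedAddCommGroup Y] [TopologicalSpace.SeparableSpace Y] [MeasurableSpace Y]
  [BorelSpace Y]

lemma exists_template (q : ℝ) (hq : 0 < q) (θ : ((i : ℕ) → K i) → ℕ → Y) (hθ : Measurable θ)
    (hfin : ∀ j (r r' : (i : Fin j) → K i) z,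
      ∑' n, ‖θ (mixF j r z) n - θ (mixF j r' z) n‖ₑ ^ q ≠ ⊤) :
    ∃ (z : (i : ℕ) → K i) (L M : ℕ → ℕ), (∀ j, j < L j) ∧
      ∀ J : Set ℕ, J.Infinite → (∀ a ∈ J, ∀ b ∈ J, a < b → M a ≤ b) →
      ∀ x x' : (i : ℕ) → K i, (∀ i, i ∉ J → x i = z i) → (∀ i, i ∉ J → x' i = z i) →
      ∀ j ∈ J,
        ((∀ i, j < i → x i = x' i) →
          ∑' n, ‖θ x (n + L j) - θ x' (n + L j)‖ₑ ^ q ≤ (2⁻¹ : ℝ≥0∞) ^ j) ∧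
        ((∀ i, i ≤ j → x i = x' i) →
          ∑ n ∈ Finset.range (L j), ‖θ x n - θ x' n‖ₑ ^ q ≤ (2⁻¹ : ℝ≥0∞) ^ j) := by
  classical
  have : SecondCountableTopology Y := UniformSpace.secondCountable_of_separable Y
  have hε : ∀ j : ℕ, (0 : ℝ≥0∞) < (2⁻¹ : ℝ≥0∞) ^ j := fun j => by
    apply ENNReal.pow_pos; simp
  let A : ℕ → ((i : ℕ) → K i) → ℕ → Prop := fun j z l =>
    ∀ r r' : (i : Fin (j+1)) → K i,
      ∑' n, ‖θ (mixF (j+1) r z) (n + l) - θ (mixF (j+1) r' z) (n + l)‖ₑ ^ q ≤ (2⁻¹ : ℝ≥0∞) ^ j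
  have hA : ∀ j z, ∃ l, A j z l := by
    intro j z
    have : ∀ᶠ l in atTop, A j z l := by
      simp only [A]
      rw [eventually_all]; intro r
      rw [eventually_all]; intro r'
      have h := ENNReal.tendsto_sum_nat_add _ (hfin (j+1) r r' z)
      exact (h.eventually_lt_const (hε j)).mono fun _ h => h.le
    exact this.exists
  have hAm : ∀ j l, MeasurableSet {z | A j z l} := by
    intro j l
    simp only [A, Set.ofPred_forall]
    refine MeasurableSet.iInter fun r => MeasurableSet.iInter fun r' => ?_
    have hm : ∀ r n, Measurable fun z => θ (mixF (j+1) r z) n := fun r n =>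
      (measurable_pi_apply n).comp (hθ.comp (continuous_mixF (j+1) r).measurable)
    refine measurableSet_le (Measurable.tsum fun n => ?_) measurable_const
    exact (((hm r _).sub (hm r' _)).enorm).pow_const q
  let N : ℕ → ((i : ℕ) → K i) → ℕ := fun j z => Nat.find (hA j z)
  have hNA : ∀ j z, A j z (N j z) := fun j z => Nat.find_spec (hA j z)
  have hNm : ∀ j, Measurable (N j) := fun j => measurable_find (hA j) (hAm j)
  obtain ⟨G₀, hG₀, hcont⟩ := exists_residual_continuousOn
    (fun z => ((θ z, fun j => N j z) : (ℕ → Y) × (ℕ → ℕ)))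
    (hθ.prodMk (measurable_pi_lambda _ hNm))
  have hcθ : ContinuousOn θ G₀ := continuous_fst.comp_continuousOn hcont
  have hcN : ∀ j, ContinuousOn (N j) G₀ := fun j =>
    ((continuous_apply j).comp continuous_snd).comp_continuousOn hcont
  obtain ⟨S, hSo, hSd, hSc, hSG⟩ := mem_residual_iff.1 hG₀
  have hres : ∀ᶠ z in residual ((i : ℕ) → K i),
      ∀ j, ∀ r : (i : Fin j) → K i, mixF j r z ∈ ⋂₀ S := by
    rw [eventually_countable_forall]; intro j
    rw [eventually_countable_forall]; intro r
    refine (tendsto_residual_of_isOpenMap (continuous_mixF j r) (isOpenMap_mixF j r)) ?_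
    exact mem_residual_iff.2 ⟨S, hSo, hSd, hSc, subset_rfl⟩
  obtain ⟨z, hz⟩ := (dense_of_mem_residual hres).nonempty
  change ∀ j, ∀ r : (i : Fin j) → K i, mixF j r z ∈ ⋂₀ S at hz
  have hzS : z ∈ ⋂₀ S := by
    have := hz 0 (fun i => z i)
    have h2 : mixF 0 (fun i => z i) z = z := by funext i; exact mixF_ge (Nat.zero_le _)
    rwa [h2] at this
  -- enumerate S
  obtain ⟨O, hO⟩ : ∃ O : ℕ → Set ((i : ℕ) → K i), (∀ k, IsOpen (O k)) ∧ ⋂₀ S = ⋂ k, O k := by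
    obtain ⟨O, hO⟩ := (hSc.insert Set.univ).exists_eq_range (Set.insert_nonempty _ _)
    refine ⟨O, fun k => ?_, ?_⟩
    · have : O k ∈ insert Set.univ S := hO ▸ Set.mem_range_self k
      rcases this with h | h
      · rw [h]; exact isOpen_univ
      · exact hSo _ h
    · rw [← Set.sInter_range, ← hO, Set.sInter_insert, Set.univ_inter]
  obtain ⟨hOo, hSO⟩ := hO
  let L : ℕ → ℕ := fun j => N j z + j + 1
  have hM : ∀ j, ∃ m, (∀ x ∈ G₀, (∀ i < m, x i = z i) → N j x = N j z) ∧
      (∀ r x, (∀ i < m, x i = mixF (j+1) r z i) → ∀ k ≤ j, x ∈ O k) ∧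
      (∀ r, ∀ x ∈ G₀, ∀ x' ∈ G₀, (∀ i < m, x i = mixF (j+1) r z i) →
        (∀ i < m, x' i = mixF (j+1) r z i) →
        ∑ n ∈ Finset.range (L j), ‖θ x n - θ x' n‖ₑ ^ q ≤ (2⁻¹ : ℝ≥0∞) ^ j) := by
    intro j
    obtain ⟨m1, hm1⟩ : ∃ m, (∀ x ∈ G₀, (∀ i < m, x i = z i) → N j x = N j z) := by
      have h1 := (hcN j) z (hSG hzS)
      have h2 : {N j z} ∈ 𝓝 (N j z) := by simp
      obtain ⟨U, hU, hUG⟩ := mem_nhdsWithin_iff_exists_mem_nhds_inter.1 (h1 h2)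
      obtain ⟨m, hm⟩ := exists_cyl hU
      exact ⟨m, fun x hx hxm => hUG ⟨hm x hxm, hx⟩⟩
    have h2 : ∀ r : (i : Fin (j+1)) → K i, ∃ m,
        ∀ x, (∀ i < m, x i = mixF (j+1) r z i) → ∀ k ≤ j, x ∈ O k := by
      intro r
      have : {x | ∀ k ≤ j, x ∈ O k} ∈ 𝓝 (mixF (j+1) r z) := by
        refine (Filter.eventually_all_finite (Set.finite_Iic j)).2 fun k _ => ?_
        refine (hOo k).mem_nhds ?_
        have := hz (j+1) r
        rw [hSO] at this
        exact Set.mem_iInter.1 this k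
      exact exists_cyl this
    have h3 : ∀ r : (i : Fin (j+1)) → K i, ∃ m,
        ∀ x ∈ G₀, ∀ x' ∈ G₀, (∀ i < m, x i = mixF (j+1) r z i) →
        (∀ i < m, x' i = mixF (j+1) r z i) →
        ∑ n ∈ Finset.range (L j), ‖θ x n - θ x' n‖ₑ ^ q ≤ (2⁻¹ : ℝ≥0∞) ^ j := by
      intro r
      set w := mixF (j+1) r z
      have hc : Continuous fun ab : (ℕ → Y) × (ℕ → Y) =>
          ∑ n ∈ Finset.range (L j), ‖ab.1 n - ab.2 n‖ₑ ^ q := by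
        refine continuous_finsetSum _ fun n _ => ?_
        refine (ENNReal.continuous_rpow_const).comp ?_
        fun_prop
      have h0 : (∑ n ∈ Finset.range (L j), ‖θ w n - θ w n‖ₑ ^ q) < (2⁻¹ : ℝ≥0∞) ^ j := by
        simp [hq, hε]
      have he := (hc.tendsto (θ w, θ w)).eventually_lt_const h0
      rw [nhds_prod_eq, eventually_prod_self_iff'] at he
      obtain ⟨V, hV, hVV⟩ := he
      obtain ⟨U, hU, hUG⟩ := mem_nhdsWithin_iff_exists_mem_nhds_inter.1
        (hcθ w (hSG (hz _ r)) hV)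
      obtain ⟨m, hm⟩ := exists_cyl hU
      refine ⟨m, fun x hx x' hx' hxm hxm' => ?_⟩
      exact (hVV _ (hUG ⟨hm x hxm, hx⟩) _ (hUG ⟨hm x' hxm', hx'⟩)).le
    choose m2 hm2 using h2
    choose m3 hm3 using h3
    obtain ⟨b2, hb2⟩ := (Set.finite_range m2).bddAbove
    obtain ⟨b3, hb3⟩ := (Set.finite_range m3).bddAbove
    have hb2 : ∀ r, m2 r ≤ b2 := fun r => hb2 (Set.mem_range_self r)
    have hb3 : ∀ r, m3 r ≤ b3 := fun r => hb3 (Set.mem_range_self r)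
    refine ⟨m1 + b2 + b3, fun x hx h => hm1 x hx fun i hi => h i (by lia), ?_, ?_⟩
    · intro r x h
      exact hm2 r x fun i hi => h i (by have := hb2 r; lia)
    · intro r x hx x' hx' h h'
      exact hm3 r x hx x' hx' (fun i hi => h i (by have := hb3 r; lia))
        (fun i hi => h' i (by have := hb3 r; lia))
  choose M hM1 hM2 hM3 using hM
  refine ⟨z, L, M, fun j => by simp only [L]; lia, ?_⟩
  intro J hJ hJM
  have hagree : ∀ x : (i : ℕ) → K i, (∀ i, i ∉ J → x i = z i) → ∀ j ∈ J, ∀ i < M j,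
      x i = mixF (j+1) (fun i => x i) z i := by
    intro x hx j hj i hi
    by_cases h : i < j + 1
    · rw [mixF_lt h]
    · rw [mixF_ge (not_lt.1 h)]
      apply hx
      intro hiJ
      have := hJM j hj i hiJ (by lia)
      lia
  have hG : ∀ x : (i : ℕ) → K i, (∀ i, i ∉ J → x i = z i) → x ∈ G₀ := by
    intro x hx
    apply hSG
    rw [hSO, Set.mem_iInter]
    intro k
    obtain ⟨j, hj, hkj⟩ := hJ.exists_gt k
    exact hM2 j (fun i => x i) x (hagree x hx j hj) k hkj.le
  intro x x' hx hx' j hj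
  constructor
  · intro hxx
    set y := mixF (j+1) (fun i => z i) x with hy
    have hyJ : ∀ i, i ∉ J → y i = z i := by
      intro i hi
      by_cases h : i < j + 1
      · rw [hy, mixF_lt h]
      · rw [hy, mixF_ge (not_lt.1 h), hx i hi]
    have hyz : ∀ i < M j, y i = z i := by
      intro i hi
      rw [hagree y hyJ j hj i hi]
      by_cases h : i < j + 1
      · rw [mixF_lt h]; simp only [hy]; rw [mixF_lt h]
      · rw [mixF_ge (not_lt.1 h)]
    have hNy := hM1 j y (hG y hyJ) hyz
    have hAy := hNA j y
    have e1 : mixF (j+1) (fun i => x i) y = x := by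
      funext i
      by_cases h : i < j + 1
      · rw [mixF_lt h]
      · rw [mixF_ge (not_lt.1 h), hy, mixF_ge (not_lt.1 h)]
    have e2 : mixF (j+1) (fun i => x' i) y = x' := by
      funext i
      by_cases h : i < j + 1
      · rw [mixF_lt h]
      · rw [mixF_ge (not_lt.1 h), hy, mixF_ge (not_lt.1 h)]
        exact hxx i (by lia)
    have := hAy (fun i => x i) (fun i => x' i)
    rw [e1, e2, hNy] at this
    refine le_trans ?_ this
    have hinj : Function.Injective fun n : ℕ => n + (j + 1) := add_left_injective _
    refine le_trans (le_of_eq ?_) (ENNReal.tsum_comp_le_tsum_of_injective hinj _)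
    refine tsum_congr fun n => ?_
    have : n + L j = n + (j + 1) + N j z := by simp only [L]; lia
    rw [this]
  · intro hxx
    refine hM3 j (fun i => x i) x (hG x hx) x' (hG x' hx') (hagree x hx j hj) ?_
    intro i hi
    rw [hagree x' hx' j hj i hi]
    by_cases h : i < j + 1
    · rw [mixF_lt h, mixF_lt h]; exact (hxx i (by lia)).symm
    · rw [mixF_ge (not_lt.1 h), mixF_ge (not_lt.1 h)]

end cat
lemma enorm_sub_rpow_le {Y : Type*} [NormedAddCommGroup Y] {q : ℝ} (hq : 1 ≤ q) (a b c : Y) :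
    ‖a - c‖ₑ ^ q ≤ 2 ^ (q - 1) * (‖a - b‖ₑ ^ q + ‖b - c‖ₑ ^ q) := by
  refine le_trans ?_ (ENNReal.rpow_add_le_mul_rpow_add_rpow _ _ hq)
  refine ENNReal.rpow_le_rpow ?_ (by linarith)
  have : a - c = (a - b) + (b - c) := by abel
  rw [this]
  exact enorm_add_le _ _

lemma two_rpow_ne_top (s : ℝ) : (2 : ℝ≥0∞) ^ s ≠ ⊤ :=
  ENNReal.rpow_ne_top_of_ne_zero (by simp) (by simp)

lemma fin_trans {Y : Type*} [NormedAddCommGroup Y] {q : ℝ} (hq : 1 ≤ q) {a b c : ℕ → Y}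
    (h1 : ∑' n, ‖a n - b n‖ₑ ^ q ≠ ⊤) (h2 : ∑' n, ‖b n - c n‖ₑ ^ q ≠ ⊤) :
    ∑' n, ‖a n - c n‖ₑ ^ q ≠ ⊤ := by
  refine ne_top_of_le_ne_top ?_ (ENNReal.tsum_le_tsum fun n => enorm_sub_rpow_le hq _ (b n) _)
  rw [ENNReal.tsum_mul_left, ENNReal.tsum_add]
  exact ENNReal.mul_ne_top (two_rpow_ne_top _) (ENNReal.add_ne_top.2 ⟨h1, h2⟩)

lemma fin_symm {Y : Type*} [NormedAddCommGroup Y] {q : ℝ} {a b : ℕ → Y}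
    (h1 : ∑' n, ‖a n - b n‖ₑ ^ q ≠ ⊤) : ∑' n, ‖b n - a n‖ₑ ^ q ≠ ⊤ := by
  have e : ∀ n, ‖b n - a n‖ₑ = ‖a n - b n‖ₑ := fun n => enorm_sub_rev _ _
  simpa only [e] using h1

lemma tsum_fiber (blk : ℕ → ℕ) (f : ℕ → ℝ≥0∞) :
    ∑' n, f n = ∑' i, ∑' n, if blk n = i then f n else 0 := by
  rw [ENNReal.tsum_comm]
  refine tsum_congr fun n => ?_
  rw [tsum_ite_eq' (blk n) (fun _ => f n)]

lemma splitting {X Y : Type*}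
    [NormedAddCommGroup X] [MeasurableSpace X] [BorelSpace X]
    [NormedAddCommGroup Y]
    [TopologicalSpace.SeparableSpace Y] [MeasurableSpace Y] [BorelSpace Y]
    (p q : ℝ) (hp : 1 ≤ p) (hq : 1 ≤ q) (θ : (ℕ → X) → ℕ → Y) (hθ : Measurable θ)
    (hred : ∀ x y, ∑' n, ‖x n - y n‖ₑ ^ p ≠ ⊤ ↔ ∑' n, ‖θ x n - θ y n‖ₑ ^ q ≠ ⊤)
    (H : ℕ → Finset X) (hH : ∀ i, (H i).Nonempty) :
    ∃ T : (i : ℕ) → H i → ℕ → Y,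
      (∀ i u, ∃ l, ∀ n, l ≤ n → T i u n = 0) ∧
      ∀ x y : (i : ℕ) → H i, ∑' i, ‖(x i : X) - y i‖ₑ ^ p ≠ ⊤ ↔
        ∑' i, ∑' n, ‖T i (x i) n - T i (y i) n‖ₑ ^ q ≠ ⊤ := by
  classical
  have hp0 : 0 < p := by linarith
  have hq0 : 0 < q := by linarith
  let τ : ℕ → ℕ := fun p => (Nat.unpair p).1
  let emb : ((i : ℕ) → H (τ i)) → ℕ → X := fun z i => (z i : X)
  have hemb : Measurable emb :=
    measurable_pi_lambda _ fun i => measurable_subtype_coe.comp (measurable_pi_apply i)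
  have hne : ∀ i, Nonempty (H (τ i)) := fun i => (hH _).to_subtype
  obtain ⟨z, L, M, hL, hLM⟩ := exists_template (K := fun i => H (τ i)) q hq0 (fun z => θ (emb z))
    (hθ.comp hemb) (by
      intro j r r' z
      rw [← hred]
      rw [tsum_eq_sum (s := Finset.range j)]
      · refine ENNReal.sum_ne_top.2 fun i _ => ?_
        exact ENNReal.rpow_ne_top_of_nonneg hp0.le enorm_ne_top
      · intro i hi
        have hi : j ≤ i := by simpa using hi
        simp only [emb]
        rw [mixF_ge hi, mixF_ge hi]
        simp [hp0])
  let jj : ℕ → ℕ := fun i => Nat.rec (motive := fun _ => ℕ) (Nat.pair 0 0)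
    (fun i ji => Nat.pair (i+1) (max (M ji) (ji + 1))) i
  have hτ : ∀ i, τ (jj i) = i := by
    intro i; cases i <;> simp [τ, jj]
  have hstep : ∀ i, max (M (jj i)) (jj i + 1) ≤ jj (i+1) := fun i => Nat.right_le_pair _ _
  have hmono : StrictMono jj := strictMono_nat_of_lt_succ fun i => by
    have := hstep i; lia
  let J : Set ℕ := Set.range jj
  have hJi : J.Infinite := Set.infinite_range_of_injective hmono.injective
  have hJM : ∀ a ∈ J, ∀ b ∈ J, a < b → M a ≤ b := by
    rintro _ ⟨a, rfl⟩ _ ⟨b, rfl⟩ hab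
    have hab' : a < b := hmono.lt_iff_lt.1 hab
    have h1 := hstep a
    have h2 : jj (a+1) ≤ jj b := hmono.monotone hab'
    lia
  have key := hLM J hJi hJM
  let h : ((i : ℕ) → H i) → (i : ℕ) → H (τ i) := fun x (i : ℕ) =>
    @ite (H (τ i)) (i = jj (τ i)) (Nat.decEq i (jj (τ i))) (x (τ i)) (z i)
  have hhJ : ∀ x i, i ∉ J → h x i = z i := by
    intro x i hi
    have : i ≠ jj (τ i) := fun he => hi ⟨τ i, he.symm⟩
    simp only [h, if_neg this]
  have hX : ∀ x y : (i : ℕ) → H i, ∑' i, ‖emb (h x) i - emb (h y) i‖ₑ ^ p =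
      ∑' i, ‖(x i : X) - y i‖ₑ ^ p := by
    intro x y
    rw [← hmono.injective.tsum_eq]
    · refine tsum_congr fun i => ?_
      simp only [emb, h]
      rw [if_pos (by rw [hτ]), if_pos (by rw [hτ]), hτ]
    · intro i hi
      by_contra hiJ
      apply hi
      simp only [emb]
      rw [hhJ x i hiJ, hhJ y i hiJ]
      simp [hp0]
  let b : (i : ℕ) → H i := fun i => ⟨(hH i).choose, (hH i).choose_spec⟩
  have hex : ∀ n, ∃ i, n < L (jj i) := fun n =>
    ⟨n, lt_of_le_of_lt hmono.le_apply (hL _)⟩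
  let blk : ℕ → ℕ := fun n => Nat.find (hex n)
  have hblk1 : ∀ n, n < L (jj (blk n)) := fun n => Nat.find_spec (hex n)
  have hblk2 : ∀ n i, i + 1 = blk n → L (jj i) ≤ n := fun n i hi =>
    not_lt.1 (Nat.find_min (hex n) (by change i < blk n; lia))
  let Φ : (i : ℕ) → H i → ℕ → Y := fun i u => θ (emb (h (Function.update b i u)))
  let T : (i : ℕ) → H i → ℕ → Y := fun i u n => if blk n = i then Φ i u n else 0
  let ψ : ((i : ℕ) → H i) → ℕ → Y := fun x n => Φ (blk n) (x (blk n)) n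
  have hψ : ∀ x, ∑' n, ‖θ (emb (h x)) n - ψ x n‖ₑ ^ q ≠ ⊤ := by
    intro x
    rw [tsum_fiber blk]
    have hbd : ∀ i, (∑' n, if blk n = i then ‖θ (emb (h x)) n - ψ x n‖ₑ ^ q else 0) ≤
        2 ^ (q - 1) * (3 * (2⁻¹ : ℝ≥0∞) ^ i) := by
      intro i
      let w : (i : ℕ) → H i := fun k => if k ≤ i then x k else b k
      let v := Function.update b i (x i)
      have hb1 : (∑' n, if n < L (jj i) then ‖θ (emb (h x)) n - θ (emb (h w)) n‖ₑ ^ q else 0) ≤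
          (2⁻¹ : ℝ≥0∞) ^ i := by
        have h1 := (key (h x) (h w) (hhJ x) (hhJ w) (jj i) ⟨i, rfl⟩).2 (by
          intro k hk
          simp only [h]
          by_cases hkj : k = jj (τ k)
          · rw [if_pos hkj, if_pos hkj]
            have : τ k ≤ i := by
              rw [← hmono.le_iff_le, ← hkj]; exact hk
            simp [w, this]
          · rw [if_neg hkj, if_neg hkj])
        rw [tsum_eq_sum (s := Finset.range (L (jj i)))]
        · refine le_trans (le_of_eq ?_) (h1.trans ?_)
          · refine Finset.sum_congr rfl fun n hn => ?_
            rw [if_pos (by simpa using hn)]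
          · exact pow_le_pow_of_le_one zero_le (by simp) hmono.le_apply
        · intro n hn
          rw [if_neg (by simpa using hn)]
      have hb2 : (∑' n, if blk n = i then ‖θ (emb (h w)) n - θ (emb (h v)) n‖ₑ ^ q else 0) ≤
          2 * (2⁻¹ : ℝ≥0∞) ^ i := by
        rcases i with _ | i
        · have hwv : w = v := by
            funext k
            by_cases hk : k = 0
            · subst hk; simp [w, v]
            · simp [w, v, hk]
          simp [hwv, hq0]
        · have h1 := (key (h w) (h v) (hhJ w) (hhJ v) (jj i) ⟨i, rfl⟩).1 (by
            intro k hk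
            simp only [h]
            by_cases hkj : k = jj (τ k)
            · rw [if_pos hkj, if_pos hkj]
              have hik : i < τ k := by
                rw [← hmono.lt_iff_lt, ← hkj]; exact hk
              generalize τ k = t at hik
              by_cases ht : t = i + 1
              · subst ht; simp [w, v]
              · have : ¬ t ≤ i + 1 := by lia
                simp [w, v, this, ht]
            · rw [if_neg hkj, if_neg hkj])
          have h2 : (2⁻¹ : ℝ≥0∞) ^ (jj i) ≤ 2 * (2⁻¹ : ℝ≥0∞) ^ (i + 1) := by
            have : 2 * (2⁻¹ : ℝ≥0∞) ^ (i + 1) = (2⁻¹ : ℝ≥0∞) ^ i := by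
              rw [pow_succ', ← mul_assoc, ENNReal.mul_inv_cancel (by simp) (by simp), one_mul]
            rw [this]
            exact pow_le_pow_of_le_one zero_le (by simp) hmono.le_apply
          refine le_trans ?_ (h1.trans h2)
          have h3 := (ENNReal.summable (f := fun n => if blk (n + L (jj i)) = i + 1 then
              ‖θ (emb (h w)) (n + L (jj i)) - θ (emb (h v)) (n + L (jj i))‖ₑ ^ q
              else 0)).sum_add_tsum_nat_add' (f := fun n => if blk n = i + 1 then
              ‖θ (emb (h w)) n - θ (emb (h v)) n‖ₑ ^ q else 0)
          rw [← h3, Finset.sum_eq_zero, zero_add]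
          · refine ENNReal.tsum_le_tsum fun n => ?_
            split_ifs
            · exact le_rfl
            · exact zero_le
          · intro n hn
            have hn : n < L (jj i) := by simpa using hn
            rw [if_neg]
            intro hb
            have := hblk2 n i hb.symm
            lia
      calc (∑' n, if blk n = i then ‖θ (emb (h x)) n - ψ x n‖ₑ ^ q else 0)
          ≤ ∑' n, 2 ^ (q - 1) *
            ((if n < L (jj i) then ‖θ (emb (h x)) n - θ (emb (h w)) n‖ₑ ^ q else 0) +
            (if blk n = i then ‖θ (emb (h w)) n - θ (emb (h v)) n‖ₑ ^ q else 0)) := by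
            refine ENNReal.tsum_le_tsum fun n => ?_
            by_cases hn : blk n = i
            · have hlt : n < L (jj i) := hn ▸ hblk1 n
              rw [if_pos hn, if_pos hn, if_pos hlt]
              have : ψ x n = θ (emb (h v)) n := by
                simp only [ψ, Φ, v]; rw [hn]
              rw [this]
              exact enorm_sub_rpow_le hq _ _ _
            · rw [if_neg hn]; exact zero_le
        _ ≤ 2 ^ (q - 1) * ((2⁻¹ : ℝ≥0∞) ^ i + 2 * (2⁻¹ : ℝ≥0∞) ^ i) := by
            rw [ENNReal.tsum_mul_left, ENNReal.tsum_add]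
            gcongr
        _ = _ := by ring
    refine ne_top_of_le_ne_top ?_ (ENNReal.tsum_le_tsum hbd)
    rw [ENNReal.tsum_mul_left, ENNReal.tsum_mul_left, ENNReal.tsum_geometric]
    refine ENNReal.mul_ne_top (two_rpow_ne_top _) (ENNReal.mul_ne_top (by simp) ?_)
    simp
  refine ⟨T, ?_, ?_⟩
  · intro i u
    refine ⟨L (jj i), fun n hn => ?_⟩
    simp only [T]
    rw [if_neg]
    intro hb
    have := hblk1 n
    rw [hb] at this
    lia
  · intro x y
    have e1 : ∑' i, ∑' n, ‖T i (x i) n - T i (y i) n‖ₑ ^ q = ∑' n, ‖ψ x n - ψ y n‖ₑ ^ q := by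
      rw [tsum_fiber blk (fun n => ‖ψ x n - ψ y n‖ₑ ^ q)]
      refine tsum_congr fun i => tsum_congr fun n => ?_
      by_cases hn : blk n = i
      · simp only [T, ψ, if_pos hn]; rw [hn]
      · simp [T, hn, hq0]
    rw [e1, ← hX, hred]
    constructor
    · intro hh
      exact fin_trans hq (fin_symm (hψ x)) (fin_trans hq hh (hψ y))
    · intro hh
      exact fin_trans hq (hψ x) (fin_trans hq hh (fin_symm (hψ y)))

lemma exists_nat_mult {a c : ℝ≥0∞} (hc : c ≠ 0) (hca : c ≤ a) (ha : a ≠ ⊤) :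
    ∃ M : ℕ, a ≤ M * c ∧ M * c ≤ 2 * a := by
  classical
  have hex : ∃ M : ℕ, a ≤ M * c := by
    obtain ⟨M, hM⟩ := ENNReal.exists_nat_mul_gt hc ha
    exact ⟨M, hM.le⟩
  refine ⟨Nat.find hex, Nat.find_spec hex, ?_⟩
  rcases hm : Nat.find hex with _ | m
  · simp
  · have : ¬ a ≤ m * c := Nat.find_min hex (by lia)
    push_cast
    rw [add_mul, one_mul, two_mul]
    exact add_le_add (not_le.1 this).le hca

lemma tsum_blocks (σ : ℕ → ℕ) (P : Set ℕ) (S : ℕ → Finset ℕ) (hS : ∀ n, ∀ i ∈ S n, σ i = n)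
    (f : ℕ → ℝ≥0∞) :
    ∑' i, {i | σ i ∈ P ∧ i ∈ S (σ i)}.indicator f i = ∑' n : P, ∑ i ∈ S n, f i := by
  classical
  rw [tsum_fiber σ, tsum_subtype P (fun n => ∑ i ∈ S n, f i)]
  refine tsum_congr fun n => ?_
  by_cases hn : n ∈ P
  · rw [Set.indicator_of_mem hn, tsum_eq_sum (s := S n)]
    · refine Finset.sum_congr rfl fun i hi => ?_
      have h1 := hS n i hi
      rw [if_pos h1, Set.indicator_of_mem]
      exact ⟨by rwa [h1], by rwa [h1]⟩
    · intro i hi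
      split_ifs with h
      · rw [Set.indicator_of_notMem]
        rintro ⟨_, h2⟩
        rw [h] at h2
        exact hi h2
      · rfl
  · rw [Set.indicator_of_notMem hn, ENNReal.tsum_eq_zero]
    intro i
    split_ifs with h
    · rw [Set.indicator_of_notMem]
      rintro ⟨h1, _⟩
      rw [h] at h1
      exact hn h1
    · rfl

lemma tsum_two_geom (P : Set ℕ) : ∑' n : P, 2 * (2⁻¹ : ℝ≥0∞) ^ (n : ℕ) ≠ ⊤ := by
  have h := ENNReal.tsum_comp_le_tsum_of_injective (f := ((↑) : P → ℕ)) Subtype.val_injective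
    (fun n : ℕ => 2 * (2⁻¹ : ℝ≥0∞) ^ n)
  refine ne_top_of_le_ne_top ?_ h
  rw [ENNReal.tsum_mul_left, ENNReal.tsum_geometric]
  exact ENNReal.mul_ne_top (by simp) (by simp)

lemma tsum_ge_one_top {P : Set ℕ} (hP : P.Infinite) {f : P → ℝ≥0∞} (hf : ∀ n, 1 ≤ f n) :
    ∑' n, f n = ⊤ := by
  have : Infinite P := hP.to_subtype
  rw [← top_le_iff, ← ENNReal.tsum_const_eq_top_of_ne_zero (α := P) one_ne_zero]
  exact ENNReal.tsum_le_tsum hf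

lemma four_mul_inv (n : ℕ) : (4 : ℝ≥0∞) ^ n * (2⁻¹ : ℝ≥0∞) ^ n = 2 ^ n := by
  rw [← mul_pow]
  congr 1
  rw [show (4 : ℝ≥0∞) = 2 * 2 by norm_num, mul_assoc, ENNReal.mul_inv_cancel (by simp) (by simp),
    mul_one]

lemma comb (d t : ℕ → ℝ≥0∞) (σ : ℕ → ℕ) (hd0 : ∀ i, d i ≠ 0)
    (hd : ∀ i, d i ≤ (2⁻¹ : ℝ≥0∞) ^ (σ i))
    (htype : ∀ n, ∃ S : Set ℕ, S.Infinite ∧ ∃ c, (∀ i ∈ S, σ i = n ∧ d i = c) ∧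
      ((∀ i ∈ S, 4 ^ n * d i ≤ t i) ∨ (∀ i ∈ S, t i ≤ (4 ^ n)⁻¹ * d i))) :
    ∃ R : Set ℕ, ¬ (∑' i, R.indicator d i ≠ ⊤ ↔ ∑' i, R.indicator t i ≠ ⊤) := by
  classical
  choose S hSi c hSc htype using htype
  have hc0 : ∀ n, c n ≠ 0 := fun n => by
    obtain ⟨i, hi⟩ := (hSi n).nonempty
    rw [← (hSc n i hi).2]; exact hd0 i
  have hcd : ∀ n, c n ≤ (2⁻¹ : ℝ≥0∞) ^ n := fun n => by
    obtain ⟨i, hi⟩ := (hSi n).nonempty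
    rw [← (hSc n i hi).2]; have := hd i; rwa [(hSc n i hi).1] at this
  let P : Set ℕ := {n | ∀ i ∈ S n, 4 ^ n * d i ≤ t i}
  by_cases hP : P.Infinite
  · have h1 : ∀ n, ∃ M : ℕ, (2⁻¹ : ℝ≥0∞) ^ n ≤ M * c n ∧ M * c n ≤ 2 * (2⁻¹ : ℝ≥0∞) ^ n :=
      fun n => exists_nat_mult (hc0 n) (hcd n) (by simp)
    choose M hM1 hM2 using h1
    choose S' hS'S hS'c using fun n => (hSi n).exists_subset_card_eq (M n)
    have hsd : ∀ n, ∑ i ∈ S' n, d i = M n * c n := fun n => by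
      rw [Finset.sum_congr rfl (fun i hi => (hSc n i (hS'S n hi)).2)]
      simp [hS'c]
    have hσ : ∀ n, ∀ i ∈ S' n, σ i = n := fun n i hi => (hSc n i (hS'S n hi)).1
    refine ⟨{i | σ i ∈ P ∧ i ∈ S' (σ i)}, ?_⟩
    rw [tsum_blocks σ P S' hσ, tsum_blocks σ P S' hσ]
    intro h
    refine h.1 ?_ (tsum_ge_one_top hP ?_)
    · simp only [hsd]
      exact ne_top_of_le_ne_top (tsum_two_geom P) (ENNReal.tsum_le_tsum fun n => hM2 n)
    · intro n
      calc (1 : ℝ≥0∞) ≤ 2 ^ (n : ℕ) := one_le_pow₀ (by norm_num)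
        _ = 4 ^ (n : ℕ) * (2⁻¹ : ℝ≥0∞) ^ (n : ℕ) := (four_mul_inv _).symm
        _ ≤ 4 ^ (n : ℕ) * ∑ i ∈ S' n, d i := by rw [hsd]; gcongr; exact hM1 n
        _ = ∑ i ∈ S' n, 4 ^ (n : ℕ) * d i := Finset.mul_sum _ _ _
        _ ≤ _ := Finset.sum_le_sum fun i hi => n.2 i (hS'S n hi)
  · have hPc : Pᶜ.Infinite := (Set.not_infinite.1 hP).infinite_compl
    have hlow : ∀ n ∈ Pᶜ, ∀ i ∈ S n, t i ≤ (4 ^ n)⁻¹ * d i := fun n hn =>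
      (htype n).resolve_left hn
    have h1 : ∀ n, ∃ M : ℕ, 1 ≤ M * c n ∧ M * c n ≤ 2 * 1 :=
      fun n => exists_nat_mult (hc0 n) ((hcd n).trans (pow_le_one₀ zero_le (by simp))) (by simp)
    choose M hM1 hM2 using h1
    choose S' hS'S hS'c using fun n => (hSi n).exists_subset_card_eq (M n)
    have hsd : ∀ n, ∑ i ∈ S' n, d i = M n * c n := fun n => by
      rw [Finset.sum_congr rfl (fun i hi => (hSc n i (hS'S n hi)).2)]
      simp [hS'c]
    have hσ : ∀ n, ∀ i ∈ S' n, σ i = n := fun n i hi => (hSc n i (hS'S n hi)).1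
    refine ⟨{i | σ i ∈ Pᶜ ∧ i ∈ S' (σ i)}, ?_⟩
    rw [tsum_blocks σ Pᶜ S' hσ, tsum_blocks σ Pᶜ S' hσ]
    intro h
    refine h.2 ?_ (tsum_ge_one_top hPc ?_)
    · refine ne_top_of_le_ne_top (tsum_two_geom Pᶜ) (ENNReal.tsum_le_tsum fun n => ?_)
      calc ∑ i ∈ S' n, t i ≤ ∑ i ∈ S' n, (4 ^ (n : ℕ))⁻¹ * d i :=
            Finset.sum_le_sum fun i hi => hlow n n.2 i (hS'S n hi)
        _ = (4 ^ (n : ℕ))⁻¹ * (M n * c n) := by rw [← Finset.mul_sum, hsd]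
        _ ≤ (2 ^ (n : ℕ))⁻¹ * (2 * 1) := by
            refine mul_le_mul' ?_ (hM2 n)
            gcongr
            norm_num
        _ = _ := by rw [ENNReal.inv_pow, mul_one, mul_comm]
    · intro n; rw [hsd]; exact hM1 n

lemma lp_enorm {Y : Type*} [NormedAddCommGroup Y] {q : ℝ} (hq : 1 ≤ q)
    (f : lp (fun _ : ℕ => Y) (ENNReal.ofReal q)) :
    ENNReal.ofReal (‖f‖ ^ q) = ∑' n, ‖f n‖ₑ ^ q := by
  have hq' : (ENNReal.ofReal q).toReal = q := ENNReal.toReal_ofReal (by linarith)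
  have h := lp.hasSum_norm (by rw [hq']; linarith) f
  rw [hq'] at h
  rw [← h.tsum_eq, ENNReal.ofReal_tsum_of_nonneg (fun n => by positivity) h.summable]
  refine tsum_congr fun n => ?_
  rw [← ENNReal.ofReal_rpow_of_nonneg (norm_nonneg _) (by linarith), ofReal_norm]

lemma scale_bad {X Y : Type*} [NormedAddCommGroup X] [NormedSpace ℝ X]
    [NormedAddCommGroup Y] [NormedSpace ℝ Y] (q α : ℝ) (hq : 1 ≤ q)
    (A : ℝ) (δ : ℝ) (hδ : 0 < δ)
    (F : Finset X) (hF : ∀ T : X → lp (fun _ : ℕ => Y) (ENNReal.ofReal q), ∃ u ∈ F, ∃ v ∈ F,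
      ¬ ((1/A) * dist u v ^ α ≤ ‖T u - T v‖ ∧ ‖T u - T v‖ ≤ A * dist u v ^ α)) :
    ∃ F : Finset X, (∀ u ∈ F, ∀ v ∈ F, ‖u - v‖ ≤ δ) ∧
    ∀ T : X → lp (fun _ : ℕ => Y) (ENNReal.ofReal q), ∃ u ∈ F, ∃ v ∈ F,
      ¬ ((1/A) * dist u v ^ α ≤ ‖T u - T v‖ ∧ ‖T u - T v‖ ≤ A * dist u v ^ α) := by
  classical
  obtain ⟨D, hD⟩ : ∃ D : ℝ, ∀ u ∈ F, ∀ v ∈ F, ‖u - v‖ ≤ D := by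
    obtain ⟨C, hC⟩ := Metric.isBounded_iff.1 F.finite_toSet.isBounded
    exact ⟨C, fun u hu v hv => by rw [← dist_eq_norm]; exact hC hu hv⟩
  set c : ℝ := δ / (|D| + 1) with hc
  have hD0 : 0 < |D| + 1 := by positivity
  have hc0 : 0 < c := by positivity
  refine ⟨F.image (c • ·), ?_, ?_⟩
  · simp only [Finset.mem_image]
    rintro _ ⟨u, hu, rfl⟩ _ ⟨v, hv, rfl⟩
    rw [← smul_sub, norm_smul, Real.norm_of_nonneg hc0.le]
    calc c * ‖u - v‖ ≤ c * (|D| + 1) := by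
          gcongr
          exact (hD u hu v hv).trans ((le_abs_self D).trans (by linarith))
      _ = δ := by rw [hc]; field_simp
  · intro T
    obtain ⟨u, hu, v, hv, h⟩ := hF (fun u => (c ^ (-α)) • T (c • u))
    refine ⟨c • u, Finset.mem_image_of_mem _ hu, c • v, Finset.mem_image_of_mem _ hv, ?_⟩
    contrapose! h
    obtain ⟨h1, h2⟩ := h
    have hd : dist (c • u) (c • v) ^ α = c ^ α * dist u v ^ α := by
      rw [dist_smul₀, Real.norm_of_nonneg hc0.le, Real.mul_rpow hc0.le dist_nonneg]
    have hn : ‖(c ^ (-α)) • T (c • u) - (c ^ (-α)) • T (c • v)‖ =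
        c ^ (-α) * ‖T (c • u) - T (c • v)‖ := by
      have hq0 : ENNReal.ofReal q ≠ 0 := by
        simp; linarith
      rw [← smul_sub, lp.norm_const_smul hq0, Real.norm_of_nonneg (by positivity)]
    have hcc : c ^ (-α) * c ^ α = 1 := by
      rw [← Real.rpow_add hc0]; simp
    have hcp : 0 < c ^ (-α) := by positivity
    rw [hd] at h1 h2
    rw [hn]
    constructor
    · calc 1 / A * dist u v ^ α = c ^ (-α) * (1 / A * (c ^ α * dist u v ^ α)) := by
            linear_combination (-(1 / A * dist u v ^ α)) * hcc
        _ ≤ _ := by gcongr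
    · calc _ ≤ c ^ (-α) * (A * (c ^ α * dist u v ^ α)) := by gcongr
        _ = _ := by linear_combination (A * dist u v ^ α) * hcc

lemma summable_iff_tsum {Y : Type*} [NormedAddCommGroup Y] {q : ℝ} (hq : 1 ≤ q) (a b : ℕ → Y) :
    (Summable fun n => ‖a n - b n‖ ^ q) ↔ ∑' n, ‖a n - b n‖ₑ ^ q ≠ ⊤ := by
  have e : ∀ n, ‖a n - b n‖ₑ ^ q = ENNReal.ofReal (‖a n - b n‖ ^ q) := fun n => by
    rw [← ENNReal.ofReal_rpow_of_nonneg (norm_nonneg _) (by linarith), ofReal_norm]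
  simp only [e]
  constructor
  · intro h; exact h.tsum_ofReal_ne_top
  · intro h
    have := ENNReal.summable_toReal h
    refine this.congr fun n => ?_
    rw [ENNReal.toReal_ofReal (by positivity)]

theorem finHolderEmb_of_reducible {X Y : Type*}
    [NormedAddCommGroup X] [NormedSpace ℝ X] [CompleteSpace X]
    [TopologicalSpace.SeparableSpace X] [MeasurableSpace X] [BorelSpace X]
    [NormedAddCommGroup Y] [NormedSpace ℝ Y] [CompleteSpace Y]
    [TopologicalSpace.SeparableSpace Y] [MeasurableSpace Y] [BorelSpace Y]
    (p q : ℝ) (hp : 1 ≤ p) (hq : 1 ≤ q)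
    (hred : BorelReducible
      (fun x y : ℕ → X => Summable fun n => ‖x n - y n‖ ^ p)
      (fun x y : ℕ → Y => Summable fun n => ‖x n - y n‖ ^ q)) :
    FinitelyHolderEmb X (lp (fun _ : ℕ => Y) (ENNReal.ofReal q)) (p/q) := by
  classical
  obtain ⟨θ, hθ, hθr⟩ := hred
  simp only [summable_iff_tsum hp, summable_iff_tsum hq] at hθr
  have hp0 : 0 < p := by linarith
  have hq0 : 0 < q := by linarith
  have hα : 0 < p / q := by positivity
  by_contra hcon
  unfold FinitelyHolderEmb at hcon
  push Not at hcon
  let A : ℕ → ℝ := fun n => ((4 : ℝ) ^ n) ^ (1 / q)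
  have hA0 : ∀ n, 0 < A n := fun n => by positivity
  have hAq : ∀ n, A n ^ q = 4 ^ n := fun n => by
    simp only [A]
    rw [← Real.rpow_mul (by positivity), one_div, inv_mul_cancel₀ hq0.ne', Real.rpow_one]
  have hF : ∀ n : ℕ, ∃ F : Finset X, (∀ u ∈ F, ∀ v ∈ F, ‖u - v‖ ≤ (2⁻¹ : ℝ) ^ n) ∧
      ∀ T : X → lp (fun _ : ℕ => Y) (ENNReal.ofReal q), ∃ u ∈ F, ∃ v ∈ F,
      ¬ ((1/A n) * dist u v ^ (p/q) ≤ ‖T u - T v‖ ∧ ‖T u - T v‖ ≤ A n * dist u v ^ (p/q)) := by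
    intro n
    obtain ⟨F, hF⟩ := hcon (A n) (hA0 n)
    refine scale_bad q (p/q) hq (A n) _ (by positivity) F fun T => ?_
    obtain ⟨u, hu, v, hv, h⟩ := hF T
    exact ⟨u, hu, v, hv, fun h' => absurd h'.2 (not_le.2 (h h'.1))⟩
  choose F hFd hFbad using hF
  let σ : ℕ → ℕ := fun i => (Nat.unpair i).1
  have hFne : ∀ n, (F n).Nonempty := fun n => by
    obtain ⟨u, hu, _⟩ := hFbad n 0
    exact ⟨u, hu⟩
  obtain ⟨T, hTs, hT⟩ := splitting p q hp hq θ hθ hθr (fun i => F (σ i)) (fun i => hFne _)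
  have hmem : ∀ i (u : F (σ i)), Memℓp (T i u) (ENNReal.ofReal q) := by
    intro i u
    obtain ⟨l, hl⟩ := hTs i u
    apply memℓp_gen
    refine summable_of_ne_finset_zero (s := Finset.range l) fun n hn => ?_
    rw [hl n (by simpa using hn), ENNReal.toReal_ofReal hq0.le]
    simp [hq0.ne']
  let Tl : ℕ → X → lp (fun _ : ℕ => Y) (ENNReal.ofReal q) := fun i u =>
    if h : u ∈ F (σ i) then ⟨T i ⟨u, h⟩, hmem i _⟩ else 0
  choose u hu v hv hbad using fun i => hFbad (σ i) (Tl i)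
  let d : ℕ → ℝ≥0∞ := fun i => ‖u i - v i‖ₑ ^ p
  let t : ℕ → ℝ≥0∞ := fun i => ∑' n, ‖T i ⟨u i, hu i⟩ n - T i ⟨v i, hv i⟩ n‖ₑ ^ q
  have hd : ∀ i, d i = ENNReal.ofReal (dist (u i) (v i) ^ p) := fun i => by
    simp only [d]
    rw [← ENNReal.ofReal_rpow_of_nonneg dist_nonneg hp0.le, dist_eq_norm, ofReal_norm]
  have ht : ∀ i, t i = ENNReal.ofReal (‖Tl i (u i) - Tl i (v i)‖ ^ q) := fun i => by
    rw [lp_enorm hq]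
    refine tsum_congr fun n => ?_
    simp only [Tl, dif_pos (hu i), dif_pos (hv i)]
    rfl
  have hpow : ∀ D : ℝ, 0 ≤ D → (D ^ (p / q)) ^ q = D ^ p := fun D hD => by
    rw [← Real.rpow_mul hD, div_mul_cancel₀ _ hq0.ne']
  have hne : ∀ i, u i ≠ v i := by
    intro i h
    apply hbad i
    rw [h]
    simp [Real.zero_rpow hα.ne']
  have hd0 : ∀ i, d i ≠ 0 := fun i => by
    simp only [d]
    rw [Ne, ENNReal.rpow_eq_zero_iff]
    simp [sub_eq_zero, hne i, hp0.le]
  have hdle : ∀ i, d i ≤ (2⁻¹ : ℝ≥0∞) ^ (σ i) := fun i => by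
    have h1 : ‖u i - v i‖ₑ ≤ (2⁻¹ : ℝ≥0∞) ^ (σ i) := by
      rw [← ofReal_norm]
      refine (ENNReal.ofReal_le_ofReal (hFd (σ i) _ (hu i) _ (hv i))).trans ?_
      rw [ENNReal.ofReal_pow (by norm_num), ENNReal.ofReal_inv_of_pos (by norm_num)]
      simp
    exact (ENNReal.rpow_le_self_of_le_one
      (h1.trans (pow_le_one₀ zero_le (by simp))) hp).trans h1
  have hfour : ∀ n : ℕ, ENNReal.ofReal ((4 : ℝ) ^ n) = 4 ^ n := fun n => by
    rw [ENNReal.ofReal_pow (by norm_num)]; simp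
  have htypes : ∀ i, 4 ^ (σ i) * d i ≤ t i ∨ t i ≤ (4 ^ (σ i))⁻¹ * d i := by
    intro i
    rw [ht, hd]
    rcases not_and_or.1 (hbad i) with h | h
    · right
      rw [← hfour, ← ENNReal.ofReal_inv_of_pos (by positivity),
        ← ENNReal.ofReal_mul (by positivity)]
      apply ENNReal.ofReal_le_ofReal
      have h2 := Real.rpow_le_rpow (lp.norm_nonneg' _) (not_le.1 h).le hq0.le
      rwa [Real.mul_rpow (by have := hA0 (σ i); positivity) (by positivity), hpow _ dist_nonneg,
        one_div, Real.inv_rpow (hA0 _).le, hAq] at h2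
    · left
      rw [← hfour, ← ENNReal.ofReal_mul (by positivity)]
      apply ENNReal.ofReal_le_ofReal
      have h2 := Real.rpow_le_rpow (by have := hA0 (σ i); positivity) (not_le.1 h).le hq0.le
      rwa [Real.mul_rpow (hA0 _).le (by positivity), hpow _ dist_nonneg, hAq] at h2
  obtain ⟨R, hR⟩ := comb d t σ hd0 hdle (by
    intro n
    let g : ℕ → X × X × Bool := fun i => (u i, v i, decide (4 ^ (σ i) * d i ≤ t i))
    have hinf : {i | σ i = n}.Infinite := by
      refine Set.infinite_of_injective_forall_mem (f := fun k => Nat.pair n k) ?_ ?_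
      · intro a b hab; simpa using hab
      · intro k; simp [σ]
    have hfi : (g '' {i | σ i = n}).Finite := by
      refine Set.Finite.subset ((F n).finite_toSet.prod ((F n).finite_toSet.prod
        (Set.finite_univ (α := Bool)))) ?_
      rintro _ ⟨i, rfl, rfl⟩
      exact ⟨hu i, hv i, trivial⟩
    obtain ⟨x, hx⟩ : ∃ x, ({i | σ i = n} ∩ g ⁻¹' {x}).Infinite := by
      by_contra hno
      push Not at hno
      exact hinf (Set.Finite.of_finite_fibers g hfi fun x _ => Set.not_infinite.1 (by simpa using hno x))
    refine ⟨_, hx, ‖x.1 - x.2.1‖ₑ ^ p, ?_, ?_⟩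
    · rintro i ⟨hi, hg⟩
      have hg : g i = x := hg
      exact ⟨hi, by rw [← hg]⟩
    · rcases hb : x.2.2 with _ | _
      · right
        rintro i ⟨hi, hg⟩
        have hg : g i = x := hg
        have hi : σ i = n := hi
        rw [← hg] at hb
        have h1 : ¬ (4 ^ (σ i) * d i ≤ t i) := by simpa [g] using hb
        rw [← hi]
        exact (htypes i).resolve_left h1
      · left
        rintro i ⟨hi, hg⟩
        have hg : g i = x := hg
        have hi : σ i = n := hi
        rw [← hg] at hb
        have h1 : (4 ^ (σ i) * d i ≤ t i) := by simpa [g] using hb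
        rwa [← hi])
  apply hR
  have hfin := hT (fun i => if i ∈ R then ⟨u i, hu i⟩ else ⟨v i, hv i⟩) (fun i => ⟨v i, hv i⟩)
  convert hfin using 3
  · funext i
    by_cases h : i ∈ R
    · simp [h, d]
    · simp [h, hp0]
  · funext i
    by_cases h : i ∈ R
    · simp [h, t]
    · simp [h, hq0]
end
end

section
/- For all r,p ∈ [1,+∞): (1) E(ℓ_r,p) is Borel reducible to E(L_r,p); (2) E(ℓ_p,p) is Borel bireducible with ℝ^ℕ/ℓ_p, and ℝ^ℕ/ℓ_p is Borel reducible to E(ℓ_r,p); (3) E(ℓ_2,p) is Borel bireducible with E(L_2,p), and E(L_2,p) is Borel reducible to E(L_r,p). -/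
open Filter Topology MeasureTheory
open scoped ENNReal NNReal

noncomputable section

/-- Borel bireducibility: reductions in both directions. -/
def BorelBireducible {α β : Type*} [MeasurableSpace α] [MeasurableSpace β]
    (E : α → α → Prop) (F : β → β → Prop) : Prop :=
  BorelReducible E F ∧ BorelReducible F E

/-- The sequence space `ℓ_r` of real sequences with summable `r`-th power. -/
abbrev ellSp (r : ℝ) : Type := lp (fun _ : ℕ => ℝ) (ENNReal.ofReal r)

/-- The Lebesgue space `L_r[0,1]` (with respect to Lebesgue measure on `[0,1]`). -/
abbrev LSp (r : ℝ) : Type :=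
  MeasureTheory.Lp ℝ (ENNReal.ofReal r) ((volume : Measure ℝ).restrict (Set.Icc 0 1))

/-- The equivalence relation `E(X,p)` on `X^ℕ`:
`x ~ y` iff `Σ_n ‖x n - y n‖^p < ∞`. -/
def ESum (X : Type*) [NormedAddCommGroup X] (p : ℝ) : (ℕ → X) → (ℕ → X) → Prop :=
  fun x y => Summable fun n => ‖x n - y n‖ ^ p

noncomputable instance {E : ℕ → Type*} [∀ i, NormedAddCommGroup (E i)] (p : ℝ≥0∞)
    [Fact (1 ≤ p)] : MeasurableSpace (lp E p) := borel _
instance {E : ℕ → Type*} [∀ i, NormedAddCommGroup (E i)] (p : ℝ≥0∞)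
    [Fact (1 ≤ p)] : BorelSpace (lp E p) := ⟨rfl⟩

noncomputable instance {α : Type*} [MeasurableSpace α] (μ : Measure α) (p : ℝ≥0∞)
    [Fact (1 ≤ p)] : MeasurableSpace (Lp ℝ p μ) := borel _
instance {α : Type*} [MeasurableSpace α] (μ : Measure α) (p : ℝ≥0∞)
    [Fact (1 ≤ p)] : BorelSpace (Lp ℝ p μ) := ⟨rfl⟩

instance : Fact (1 ≤ ENNReal.ofReal 2) := ⟨ENNReal.one_le_ofReal.2 one_le_two⟩

open ProbabilityTheory

lemma red_of_map {X Y : Type*} [NormedAddCommGroup X] [NormedAddCommGroup Y]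
    [MeasurableSpace X] [BorelSpace X] [MeasurableSpace Y] [BorelSpace Y] (p : ℝ)
    (T : X → Y) (c : ℝ) (hc : 0 < c) (hT : ∀ x y, ‖T x - T y‖ = c * ‖x - y‖) :
    BorelReducible (ESum X p) (ESum Y p) := by
  have hcont : Continuous T := by
    refine (LipschitzWith.of_dist_le_mul (K := ⟨c, hc.le⟩) fun x y => ?_).continuous
    rw [dist_eq_norm, dist_eq_norm, hT]; rfl
  refine ⟨fun x n => T (x n), ?_, fun x y => ?_⟩
  · exact measurable_pi_iff.2 fun n => hcont.measurable.comp (measurable_pi_apply n)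
  · simp only [ESum, hT]
    have : ∀ n, (c * ‖x n - y n‖) ^ p = c ^ p * ‖x n - y n‖ ^ p := fun n =>
      Real.mul_rpow hc.le (norm_nonneg _)
    simp only [this]
    exact (summable_mul_left_iff (Real.rpow_pos_of_pos hc p).ne').symm

lemma toReal_pos_of_fact {r : ℝ} (hr : 1 ≤ r) : (ENNReal.ofReal r).toReal = r :=
  ENNReal.toReal_ofReal (by linarith)

lemma red_ell_R (p : ℝ) (hp : 1 ≤ p) [Fact (1 ≤ ENNReal.ofReal p)] :
    BorelReducible (ESum (ellSp p) p) (fun x y : ℕ → ℝ => Summable fun n => |x n - y n| ^ p) := by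
  refine ⟨fun x n => x (Nat.unpair n).1 (Nat.unpair n).2, ?_, fun x y => ?_⟩
  · refine measurable_pi_iff.2 fun n => ?_
    exact (lp.evalCLM ℝ (fun _ : ℕ => ℝ) (ENNReal.ofReal p) (Nat.unpair n).2).continuous.measurable.comp
      (measurable_pi_apply (Nat.unpair n).1)
  · have h0 : 0 < (ENNReal.ofReal p).toReal := by rw [toReal_pos_of_fact hp]; linarith
    have e := Nat.pairEquiv.symm.summable_iff (f := fun q : ℕ × ℕ => |x q.1 q.2 - y q.1 q.2| ^ p)
    have e2 : (Summable fun n : ℕ => |x (Nat.unpair n).1 (Nat.unpair n).2 - y (Nat.unpair n).1 (Nat.unpair n).2| ^ p) ↔ Summable (fun q : ℕ × ℕ => |x q.1 q.2 - y q.1 q.2| ^ p) := e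
    have hs : ∀ n, Summable fun m => |x n m - y n m| ^ p := fun n => by
      have := (lp.hasSum_norm h0 (x n - y n)).summable
      simpa [toReal_pos_of_fact hp] using this
    have hn : ∀ n, ‖x n - y n‖ ^ p = ∑' m, |x n m - y n m| ^ p := fun n => by
      have := lp.norm_rpow_eq_tsum h0 (x n - y n)
      simpa [toReal_pos_of_fact hp] using this
    refine Iff.trans ?_ e2.symm
    rw [summable_prod_of_nonneg (fun _ => by positivity)]
    simp only [ESum, hn]
    exact ⟨fun h => ⟨hs, h⟩, fun h => h.2⟩

lemma red_R_ell (p r : ℝ) (hr : 1 ≤ r) [Fact (1 ≤ ENNReal.ofReal r)] :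
    BorelReducible (fun x y : ℕ → ℝ => Summable fun n => |x n - y n| ^ p)
      (ESum (ellSp r) p) := by
  have h0 : 0 < ENNReal.ofReal r := by simp; linarith
  have := red_of_map (X := ℝ) (Y := ellSp r) p
    (fun t => lp.single (ENNReal.ofReal r) 0 t) 1 one_pos (fun x y => by
      rw [← lp.single_sub, lp.norm_single h0, one_mul])
  exact this

lemma exists_map_Icc {Y : Type*} [MeasurableSpace Y] [StandardBorelSpace Y] (μ : Measure Y)
    [IsProbabilityMeasure μ] :
    ∃ f : ℝ → Y, MeasurePreserving f ((volume : Measure ℝ).restrict (Set.Icc 0 1)) μ := by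
  have : Nonempty Y := nonempty_of_isProbabilityMeasure μ
  obtain ⟨f, hf, hm⟩ := μ.exists_measurable_map_eq
  have hpm : Measurable (Set.projIcc (0:ℝ) 1 zero_le_one) := continuous_projIcc.measurable
  refine ⟨fun t => f (Set.projIcc 0 1 zero_le_one t), hf.comp hpm, ?_⟩
  rw [← hm, ← map_comap_subtype_coe measurableSet_Icc]
  change Measure.map (f ∘ Set.projIcc (0:ℝ) 1 zero_le_one) _ = _
  rw [Measure.map_map (hf.comp hpm) measurable_subtype_coe]
  have : (f ∘ Set.projIcc (0:ℝ) 1 zero_le_one) ∘ Subtype.val = f := by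
    ext t
    simp
  rw [this]
  rfl

lemma red_ell_L (r p : ℝ) (hr : 1 ≤ r) [Fact (1 ≤ ENNReal.ofReal r)] :
    BorelReducible (ESum (ellSp r) p) (ESum (LSp r) p) := by
  have h0 : 0 < (ENNReal.ofReal r).toReal := by rw [toReal_pos_of_fact hr]; linarith
  have hr0 : 0 < r := by linarith
  let ν : Measure ℕ := poissonMeasure 1
  have hν : ∀ n, ν {n} ≠ 0 := fun n => by
    simp only [ν, poissonMeasure_singleton]
    simp
    positivity
  have hν' : ∀ n, ν {n} ≠ ∞ := fun n => measure_ne_top _ _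
  obtain ⟨φ, hφ⟩ := exists_map_Icc ν
  let c : ℕ → ℝ := fun n => ((ν {n}).toReal) ^ (-(1/r))
  have key : ∀ x : ellSp r, eLpNorm (fun n => x n * c n) (ENNReal.ofReal r) ν = ENNReal.ofReal ‖x‖ := by
    intro x
    rw [eLpNorm_eq_lintegral_rpow_enorm_toReal (by simpa using hr0) (by simp), lintegral_countable']
    rw [toReal_pos_of_fact hr]
    have hterm : ∀ n, ‖x n * c n‖ₑ ^ r * ν {n} = ENNReal.ofReal (‖x n‖ ^ r) := by
      intro n
      have hpos : 0 < (ν {n}).toReal := ENNReal.toReal_pos (hν n) (hν' n)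
      rw [← ofReal_norm, ENNReal.ofReal_rpow_of_nonneg (norm_nonneg _) hr0.le, ← ENNReal.ofReal_toReal (hν' n),
        ← ENNReal.ofReal_mul (by positivity), norm_mul, Real.mul_rpow (norm_nonneg _) (norm_nonneg _)]
      congr 1
      have : ‖c n‖ ^ r = ((ν {n}).toReal)⁻¹ := by
        rw [Real.norm_of_nonneg (by positivity)]
        simp only [c]
        rw [← Real.rpow_mul hpos.le, ← Real.rpow_neg_one]
        congr 1
        field_simp
      rw [this]
      field_simp
    simp only [hterm]
    have hs := lp.hasSum_norm h0 x
    rw [toReal_pos_of_fact hr] at hs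
    rw [← ENNReal.ofReal_tsum_of_nonneg (fun n => by positivity) hs.summable, hs.tsum_eq,
      ENNReal.ofReal_rpow_of_nonneg (by positivity) (by positivity), ← Real.rpow_mul (norm_nonneg _)]
    congr 1
    rw [mul_one_div_cancel hr0.ne', Real.rpow_one]
  have hmem : ∀ x : ellSp r, MemLp (fun n => x n * c n) (ENNReal.ofReal r) ν := fun x =>
    ⟨(measurable_of_countable _).aestronglyMeasurable, by rw [key]; exact ENNReal.ofReal_lt_top⟩
  refine red_of_map p (fun x => ((hmem x).comp_measurePreserving hφ).toLp _) 1 one_pos fun x y => ?_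
  rw [← MemLp.toLp_sub, Lp.norm_toLp, one_mul]
  have : ((fun n => x n * c n) ∘ φ - (fun n => y n * c n) ∘ φ) = (fun n => (x - y : ellSp r) n * c n) ∘ φ := by
    ext t; simp [sub_mul]
  rw [this, eLpNorm_comp_measurePreserving (hmem _).1 hφ, key, ENNReal.toReal_ofReal (norm_nonneg _)]

lemma gauss_law (a : ℕ → ℝ) (s : Finset ℕ) :
    (Measure.infinitePi fun _ : ℕ => gaussianReal 0 1).map (fun ω : ℕ → ℝ => ∑ i ∈ s, a i * ω i)
      = gaussianReal 0 (∑ i ∈ s, (‖a i‖₊) ^ 2) := by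
  set P := Measure.infinitePi fun _ : ℕ => gaussianReal 0 1 with hP
  have hind : iIndepFun (fun i (ω : ℕ → ℝ) => a i * ω i) P :=
    iIndepFun_infinitePi (X := fun i t => a i * t) (fun i => by fun_prop)
  have hlaw : ∀ i, P.map (fun ω : ℕ → ℝ => a i * ω i) = gaussianReal 0 (‖a i‖₊ ^ 2) := by
    intro i
    have : (fun ω : ℕ → ℝ => a i * ω i) = (a i * ·) ∘ (fun ω : ℕ → ℝ => ω i) := rfl
    rw [this, ← Measure.map_map (by fun_prop) (by fun_prop), hP]
    have h2 := Measure.infinitePi_map_eval (fun _ : ℕ => gaussianReal 0 1) i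
    rw [h2, gaussianReal_map_const_mul]
    congr 1
    · simp
    · ext; simp
  induction s using Finset.induction_on with
  | empty => simp [Measure.map_const, gaussianReal_zero_var]
  | insert i s hi ih =>
    have h1 := hind.indepFun_finsetSum_of_notMem (fun i => by fun_prop) hi
    have h2 : (∑ j ∈ s, fun ω : ℕ → ℝ => a j * ω j) = fun ω => ∑ j ∈ s, a j * ω j := by
      ext; simp
    rw [h2] at h1
    have := gaussianReal_add_gaussianReal_of_indepFun h1 ih (hlaw i)
    simp only [Finset.sum_insert hi]
    rw [add_comm (_ ^ 2), ← zero_add (0:ℝ), ← this]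
    congr 1
    ext ω
    simp [add_comm]

lemma meas_sum_aux (a : ℕ → ℝ) (s : Finset ℕ) :
    Measurable (fun ω : ℕ → ℝ => ∑ i ∈ s, a i * ω i) := by
  refine Finset.measurable_fun_sum s fun i _ => ?_
  have h : Measurable (fun ω : ℕ → ℝ => ω i) := measurable_pi_apply i
  exact h.const_mul (a i)

lemma gauss_norm (q : ℝ≥0∞) (a : ℕ → ℝ) (s : Finset ℕ) :
    eLpNorm (fun ω : ℕ → ℝ => ∑ i ∈ s, a i * ω i) q
      (Measure.infinitePi fun _ : ℕ => gaussianReal 0 1)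
      = ENNReal.ofReal (√(∑ i ∈ s, a i ^ 2)) * eLpNorm id q (gaussianReal 0 1) := by
  have h0 : 0 ≤ ∑ i ∈ s, a i ^ 2 := Finset.sum_nonneg fun i _ => sq_nonneg _
  have h1 := eLpNorm_map_measure (p := q) (μ := Measure.infinitePi fun _ : ℕ => gaussianReal 0 1)
    (f := fun ω : ℕ → ℝ => ∑ i ∈ s, a i * ω i) (g := id)
    aestronglyMeasurable_id
    (meas_sum_aux a s).aemeasurable
  rw [Function.id_comp] at h1
  rw [← h1, gauss_law]
  have h2 : gaussianReal 0 (∑ i ∈ s, (‖a i‖₊) ^ 2)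
      = (gaussianReal 0 1).map (√(∑ i ∈ s, a i ^ 2) * ·) := by
    rw [gaussianReal_map_const_mul]
    congr 1
    · simp
    · ext; simp [Real.sq_sqrt h0]
  rw [h2, eLpNorm_map_measure aestronglyMeasurable_id (by fun_prop)]
  have h3 : (id ∘ fun x : ℝ => √(∑ i ∈ s, a i ^ 2) * x) = √(∑ i ∈ s, a i ^ 2) • (id : ℝ → ℝ) := by
    ext; simp
  rw [h3, eLpNorm_const_smul, ← ofReal_norm, Real.norm_of_nonneg (Real.sqrt_nonneg _)]

lemma gauss_ne_zero (q : ℝ≥0∞) (hq : q ≠ 0) : eLpNorm id q (gaussianReal 0 1) ≠ 0 := by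
  intro h
  rw [eLpNorm_eq_zero_iff aestronglyMeasurable_id hq] at h
  have h1 : (gaussianReal 0 1) {x : ℝ | ¬ x = 0} = 0 := h
  have hna := nullSingletonClass_gaussianReal (μ := 0) (v := 1) one_ne_zero
  have h2 : (gaussianReal 0 1) {x : ℝ | x = 0} = 0 := by
    rw [Set.ofPred_eq_eq_singleton]; exact measure_singleton _
  have h3 : (gaussianReal 0 1) (Set.univ : Set ℝ) ≤ 0 := by
    refine (measure_mono (t := {x : ℝ | x = 0} ∪ {x : ℝ | ¬ x = 0}) ?_).trans
      ((measure_union_le _ _).trans ?_)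
    · intro x _; exact em _
    · rw [h1, h2, add_zero]
  simp at h3

lemma toLp_sum_aux {μ : Measure ℝ} {q : ℝ≥0∞} (g : ℕ → ℝ → ℝ) (hg : ∀ i, MemLp (g i) q μ)
    (a : ℕ → ℝ) (s : Finset ℕ) (h : MemLp (fun t => ∑ i ∈ s, a i * g i t) q μ) :
    ∑ i ∈ s, a i • (hg i).toLp (g i) = h.toLp _ := by
  induction s using Finset.induction_on with
  | empty =>
    simp only [Finset.sum_empty]
    exact (MemLp.toLp_zero h).symm
  | insert i s hi ih =>
    have hs : MemLp (fun t => ∑ i ∈ s, a i * g i t) q μ :=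
      memLp_finsetSum s fun i _ => (hg i).const_mul (a i)
    rw [Finset.sum_insert hi, ih hs, ← MemLp.toLp_const_smul, ← MemLp.toLp_add]
    refine (MemLp.toLp_eq_toLp_iff _ _).2 (Eventually.of_forall fun t => ?_)
    simp [Finset.sum_insert hi]

lemma red_ell2_L (r p : ℝ) (hr : 1 ≤ r) [Fact (1 ≤ ENNReal.ofReal r)] :
    BorelReducible (ESum (ellSp 2) p) (ESum (LSp r) p) := by
  have hr0 : 0 < r := by linarith
  set P := Measure.infinitePi fun _ : ℕ => gaussianReal 0 1 with hP
  obtain ⟨φ, hφ⟩ := exists_map_Icc P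
  set q := ENNReal.ofReal r with hq
  have hq0 : q ≠ 0 := by simpa [hq] using hr0
  set K := eLpNorm id q (gaussianReal 0 1) with hK
  have hKtop : K ≠ ∞ := (memLp_id_gaussianReal' q (by simp [hq])).2.ne
  have hK0 : K ≠ 0 := gauss_ne_zero q hq0
  have hmemP : ∀ (a : ℕ → ℝ) (s : Finset ℕ),
      MemLp (fun ω : ℕ → ℝ => ∑ i ∈ s, a i * ω i) q P := fun a s =>
    ⟨(meas_sum_aux a s).aestronglyMeasurable,
      by rw [gauss_norm]; exact ENNReal.mul_lt_top ENNReal.ofReal_lt_top hKtop.lt_top⟩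
  have hmem : ∀ (a : ℕ → ℝ) (s : Finset ℕ),
      MemLp (fun t => ∑ i ∈ s, a i * φ t i) q ((volume : Measure ℝ).restrict (Set.Icc 0 1)) :=
    fun a s => (hmemP a s).comp_measurePreserving hφ
  have hg : ∀ i : ℕ, MemLp (fun t => φ t i) q ((volume : Measure ℝ).restrict (Set.Icc 0 1)) := by
    intro i
    simpa using hmem (fun _ => 1) {i}
  have hsum : ∀ (a : ℕ → ℝ) (s : Finset ℕ),
      ∑ i ∈ s, a i • (hg i).toLp _ = (hmem a s).toLp _ := by
    intro a s
    exact toLp_sum_aux _ hg a s (hmem a s)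
  have hnorm : ∀ (a : ℕ → ℝ) (s : Finset ℕ),
      ‖∑ i ∈ s, a i • (hg i).toLp _‖ = K.toReal * √(∑ i ∈ s, a i ^ 2) := by
    intro a s
    rw [hsum, Lp.norm_toLp]
    have := eLpNorm_comp_measurePreserving (p := q) (hmemP a s).1 hφ
    have h' : ((fun ω : ℕ → ℝ => ∑ i ∈ s, a i * ω i) ∘ φ) = fun t => ∑ i ∈ s, a i * φ t i := rfl
    rw [h', gauss_norm] at this
    rw [this, ENNReal.toReal_mul, ENNReal.toReal_ofReal (Real.sqrt_nonneg _), mul_comm]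
  have h2 : (ENNReal.ofReal 2).toReal = 2 := toReal_pos_of_fact one_le_two
  let e : (ℕ →₀ ℝ) →ₗ[ℝ] ellSp 2 :=
    Finsupp.linearCombination ℝ fun i => (lp.single (ENNReal.ofReal 2) i (1:ℝ) : ellSp 2)
  let f : (ℕ →₀ ℝ) →ₗ[ℝ] LSp r := Finsupp.linearCombination ℝ fun i => (hg i).toLp _
  have he : ∀ a, e a = ∑ i ∈ a.support, (lp.single (ENNReal.ofReal 2) i (a i) : ellSp 2) := by
    intro a
    simp only [e, Finsupp.linearCombination_apply, Finsupp.sum]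
    refine Finset.sum_congr rfl fun i _ => ?_
    rw [← lp.single_smul, smul_eq_mul, mul_one]
  have hen : ∀ a, ‖e a‖ = √(∑ i ∈ a.support, a i ^ 2) := by
    intro a
    have := lp.norm_sum_single (p := ENNReal.ofReal 2) (E := fun _ : ℕ => ℝ)
      (by rw [h2]; norm_num) a a.support
    rw [← he, h2] at this
    simp only [Real.rpow_two, Real.norm_eq_abs, sq_abs] at this
    rw [← this, Real.sqrt_sq (norm_nonneg _)]
  have hfe : ∀ a, ‖f a‖ = K.toReal * ‖e a‖ := by
    intro a
    rw [hen, ← hnorm]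
    rfl
  have hdense : DenseRange e := by
    intro x
    refine mem_closure_of_tendsto (lp.hasSum_single (by simp) x) (Eventually.of_forall fun s => ?_)
    refine ⟨∑ i ∈ s, Finsupp.single i (x i), ?_⟩
    rw [map_sum]
    refine Finset.sum_congr rfl fun i _ => ?_
    simp only [e, Finsupp.linearCombination_single]
    rw [← lp.single_smul, smul_eq_mul, mul_one]
  let T := f.extendOfNorm e
  have hT : ∀ x, ‖T x‖ = K.toReal * ‖x‖ := by
    intro x
    refine hdense.induction_on (p := fun x => ‖T x‖ = K.toReal * ‖x‖) x
      (isClosed_eq (by fun_prop) (by fun_prop)) fun a => ?_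
    rw [LinearMap.extendOfNorm_eq hdense ⟨K.toReal, fun a => (hfe a).le⟩, hfe]
  exact red_of_map p T K.toReal (ENNReal.toReal_pos hK0 hKtop) fun x y => by rw [← map_sub, hT]

lemma hilbert_embed (H : Type*) [NormedAddCommGroup H] [InnerProductSpace ℝ H] [CompleteSpace H]
    [SecondCountableTopology H] :
    ∃ T : H → lp (fun _ : ℕ => ℝ) 2, ∀ x y, ‖T x - T y‖ = ‖x - y‖ := by
  obtain ⟨w, b, hb⟩ := exists_hilbertBasis ℝ H
  have hw : w.Countable := by
    refine Set.PairwiseDisjoint.countable_of_isOpen (s := fun x => Metric.ball x (1/2)) ?_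
      (fun _ _ => Metric.isOpen_ball) (fun x _ => ⟨x, by simp⟩)
    intro x hx y hy hxy
    refine Metric.ball_disjoint_ball ?_
    have ho := b.orthonormal
    have hxn : ‖x‖ = 1 := by simpa [hb] using ho.1 ⟨x, hx⟩
    have hyn : ‖y‖ = 1 := by simpa [hb] using ho.1 ⟨y, hy⟩
    have hi : inner ℝ x y = 0 := by
      simpa [hb] using ho.2 (i := ⟨x, hx⟩) (j := ⟨y, hy⟩) (by simpa using hxy)
    have := norm_sub_sq_real x y
    rw [hi, hxn, hyn] at this
    rw [dist_eq_norm]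
    nlinarith [norm_nonneg (x - y)]
  have : Countable w := hw.to_subtype
  obtain ⟨j, hj⟩ := exists_injective_nat w
  have hon : Orthonormal ℝ (fun i : w => (lp.single 2 (j i) (1:ℝ) : lp (fun _ : ℕ => ℝ) 2)) := by
    classical
    rw [orthonormal_iff_ite]
    intro i k
    rw [lp.inner_single_left]
    simp [Pi.single_apply, hj.eq_iff]
  let S := hon.orthogonalFamily.linearIsometry
  refine ⟨fun x => S (b.repr x), fun x y => ?_⟩
  rw [← map_sub, ← map_sub, LinearIsometry.norm_map, LinearIsometryEquiv.norm_map]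

lemma L2_embed (q : ℝ≥0∞) (hq : q = 2) [Fact (1 ≤ q)] :
    ∃ T : Lp ℝ q ((volume : Measure ℝ).restrict (Set.Icc 0 1)) → lp (fun _ : ℕ => ℝ) q,
      ∀ x y, ‖T x - T y‖ = ‖x - y‖ := by
  subst hq
  have : Fact ((2 : ℝ≥0∞) ≠ ∞) := ⟨by simp⟩
  exact hilbert_embed _

lemma red_L2_ell2 (p : ℝ) : BorelReducible (ESum (LSp 2) p) (ESum (ellSp 2) p) := by
  obtain ⟨T, hT⟩ := L2_embed (ENNReal.ofReal 2) (by simp)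
  exact red_of_map p T 1 one_pos fun x y => by rw [hT, one_mul]

lemma BorelReducible.trans' {α β γ : Type*} [MeasurableSpace α] [MeasurableSpace β]
    [MeasurableSpace γ] {E : α → α → Prop} {F : β → β → Prop} {G : γ → γ → Prop}
    (h : BorelReducible E F) (h' : BorelReducible F G) : BorelReducible E G := by
  obtain ⟨f, hf, hf'⟩ := h
  obtain ⟨g, hg, hg'⟩ := h'
  exact ⟨g ∘ f, hg.comp hf, fun x y => (hf' x y).trans (hg' _ _)⟩

theorem ell_L_reducibility (r p : ℝ) (hr : 1 ≤ r) (hp : 1 ≤ p)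
    [Fact (1 ≤ ENNReal.ofReal r)] [Fact (1 ≤ ENNReal.ofReal p)] :
    BorelReducible (ESum (ellSp r) p) (ESum (LSp r) p) ∧
    (BorelBireducible (ESum (ellSp p) p)
        (fun x y : ℕ → ℝ => Summable fun n => |x n - y n| ^ p) ∧
      BorelReducible (fun x y : ℕ → ℝ => Summable fun n => |x n - y n| ^ p)
        (ESum (ellSp r) p)) ∧
    (BorelBireducible (ESum (ellSp 2) p) (ESum (LSp 2) p) ∧
      BorelReducible (ESum (LSp 2) p) (ESum (LSp r) p)) := by
  exact ⟨red_ell_L r p hr, ⟨⟨red_ell_R p hp, red_R_ell p p hp⟩, red_R_ell p r hr⟩,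
    ⟨red_ell_L 2 p one_le_two, red_L2_ell2 p⟩, (red_L2_ell2 p).trans' (red_ell2_L r p hr)⟩
end
end
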